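/- Let k ≥ 1, let A_1, …, A_k be pairwise disjoint bounded rectangles in [0,1]^d, and let R_1, …, R_k ⊆ (−∞,+∞] each be a finite union of disjoint intervals of the form (x,y] with −∞ < x < y ≤ +∞. Then P( for every j ∈ {1,…,k} and every α ∈ nA_j ∩ V_N one has (φ_α − b_N)/a_N ∉ R_j ) converges, as n → ∞, to exp(−Σ_{j=1}^k |A_j|·ω(R_j)). (This is the avoidance-probability formulation of the convergence of the extremal process Σ_{α∈V_N} ε_{(α/n, (φ_α−b_N)/a_N)} to a Poisson point process on [0,1]^d × (−∞,+∞] with intensity dt ⊗ e^{−z}dz.) -/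

import Mathlib

open MeasureTheory ProbabilityTheory Real Filter Set

/-- `ℤ^d` as functions `Fin d → ℤ`. -/
abbrev Zd (d : ℕ) := Fin d → ℤ

/-- One step of the simple random walk: move from `a` by `±1` in coordinate `i`. -/
def rwStep (d : ℕ) (i : Fin d) (s : Bool) (a : Zd d) : Zd d :=
  Function.update a i (a i + if s then 1 else -1)

/-- `m`-step transition probability of the simple random walk on `ℤ^d`. -/
noncomputable def rwP (d : ℕ) : ℕ → Zd d → Zd d → ℝ
  | 0, a, b => if a = b then 1 else 0
  | (m+1), a, b => (1 / (2 * d)) * ∑ i : Fin d, ∑ s : Bool, rwP d m (rwStep d i s a) b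

/-- The Green's function `g(a,b)` of the simple random walk on `ℤ^d`. -/
noncomputable def green (d : ℕ) (a b : Zd d) : ℝ := ∑' m, rwP d m a b

open Classical in
/-- Probability that the walk started at `a` is at `b` at time `m`, having stayed in `Λ`
at all times `0,…,m`. -/
noncomputable def rwPIn (d : ℕ) (Λ : Set (Zd d)) : ℕ → Zd d → Zd d → ℝ
  | 0, a, b => if a = b ∧ a ∈ Λ then 1 else 0
  | (m+1), a, b =>
      if a ∈ Λ then (1 / (2 * d)) * ∑ i : Fin d, ∑ s : Bool, rwPIn d Λ m (rwStep d i s a) b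
      else 0

/-- Dirichlet Green's function `g_Λ(a,b)` (killed upon exiting `Λ`). -/
noncomputable def greenIn (d : ℕ) (Λ : Set (Zd d)) (a b : Zd d) : ℝ := ∑' m, rwPIn d Λ m a b

open Classical in
/-- Probability that the walk started at `a` first hits `F` at time `m`, at the point `b`. -/
noncomputable def hitP (d : ℕ) (F : Set (Zd d)) : ℕ → Zd d → Zd d → ℝ
  | 0, a, b => if a = b ∧ b ∈ F then 1 else 0
  | (m+1), a, b =>
      if a ∈ F then 0
      else (1 / (2 * d)) * ∑ i : Fin d, ∑ s : Bool, hitP d F m (rwStep d i s a) b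

open Classical in
/-- Probability that the walk started at `a` first hits `F` at time `m`, at the point `b`,
before exiting `Λ`. -/
noncomputable def hitPIn (d : ℕ) (Λ F : Set (Zd d)) : ℕ → Zd d → Zd d → ℝ
  | 0, a, b => if a = b ∧ b ∈ F ∧ b ∈ Λ then 1 else 0
  | (m+1), a, b =>
      if a ∈ Λ ∧ a ∉ F then
        (1 / (2 * d)) * ∑ i : Fin d, ∑ s : Bool, hitPIn d Λ F m (rwStep d i s a) b
      else 0

/-- `ℙ_a(H_F < ∞, S_{H_F} = b)`, the harmonic measure of `F` seen from `a`. -/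
noncomputable def hitMeas (d : ℕ) (F : Set (Zd d)) (a b : Zd d) : ℝ := ∑' m, hitP d F m a b

/-- `ℙ_a(H_F < H_{ℤ^d∖Λ}, S_{H_F} = b)`. -/
noncomputable def hitMeasIn (d : ℕ) (Λ F : Set (Zd d)) (a b : Zd d) : ℝ :=
  ∑' m, hitPIn d Λ F m a b

/-- `(φ_a)_{a∈ℤ^d}` is a centered Gaussian field with covariance `G`: every finite linear
combination is a centered Gaussian with the prescribed variance. -/
def IsGaussianField {Ω : Type*} [MeasurableSpace Ω] (P : Measure Ω) (d : ℕ)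
    (G : Zd d → Zd d → ℝ) (φ : Zd d → Ω → ℝ) : Prop :=
  (∀ a, Measurable (φ a)) ∧
    ∀ c : Zd d →₀ ℝ,
      Measure.map (fun ω => ∑ a ∈ c.support, c a * φ a ω) P =
        gaussianReal 0
          (Real.toNNReal (∑ a ∈ c.support, ∑ b ∈ c.support, c a * c b * G a b))

/-- The centering sequence `b_N` (here `g0 = g(0)` is the variance of the field). -/
noncomputable def bN (g0 : ℝ) (N : ℕ) : ℝ :=
  Real.sqrt g0 * (Real.sqrt (2 * Real.log N) -
    (Real.log (Real.log N) + Real.log (4 * π)) / (2 * Real.sqrt (2 * Real.log N)))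

/-- The scaling sequence `a_N = g(0)/b_N`. -/
noncomputable def aN (g0 : ℝ) (N : ℕ) : ℝ := g0 / bN g0 N

/-- `u_N(z) = a_N z + b_N`. -/
noncomputable def uN (g0 : ℝ) (N : ℕ) (z : ℝ) : ℝ := aN g0 N * z + bN g0 N

/-- The box `V_N = ([0,n-1]^d) ∩ ℤ^d`, `N = n^d`. -/
noncomputable def VN (d n : ℕ) : Finset (Zd d) :=
  Fintype.piFinset fun _ => Finset.Icc (0 : ℤ) ((n : ℤ) - 1)

/-- The `ℓ∞` distance between two points of `ℤ^d`, as a real number. -/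
noncomputable def distInf (d : ℕ) (a b : Zd d) : ℝ :=
  ((Finset.univ.sup fun i => (a i - b i).natAbs : ℕ) : ℝ)

open Classical in
/-- The bulk `V_N^δ` of the box `V_N`. -/
noncomputable def bulk (d n : ℕ) (δ : ℝ) : Finset (Zd d) :=
  (VN d n).filter fun a => ∀ b : Zd d, b ∉ VN d n → δ * n < distInf d a b

/-- The rectangle `∏_i ([0,1] ∩ (lo i, hi i])` in `[0,1]^d`. -/
def rect (d : ℕ) (lo hi : Fin d → ℝ) : Set (Fin d → ℝ) :=
  {t | ∀ i, t i ∈ Set.Icc (0 : ℝ) 1 ∩ Set.Ioc (lo i) (hi i)}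

open Classical in
/-- `nA ∩ V_N = {α ∈ V_N : α/n ∈ A}` for the rectangle `A = rect d lo hi`. -/
noncomputable def rectIdx (d n : ℕ) (lo hi : Fin d → ℝ) : Finset (Zd d) :=
  (VN d n).filter fun a => (fun i => (a i : ℝ) / n) ∈ rect d lo hi

/-- `e^{-y}` for `y ∈ (-∞,+∞]`, with the convention `e^{-∞} = 0`. -/
noncomputable def expE (y : EReal) : ℝ := if y = ⊤ then 0 else Real.exp (-y.toReal)

/-- `u_N` extended to `(-∞,+∞]` by `u_N(+∞) = +∞`. -/
noncomputable def uNE (g0 : ℝ) (N : ℕ) (y : EReal) : EReal :=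
  if y = ⊤ then ⊤ else ((uN g0 N y.toReal : ℝ) : EReal)

/-- `ω(R) = ∫_R e^{-z} dz` for `R ⊆ (-∞,+∞]`. -/
noncomputable def omegaMeas (R : Set EReal) : ℝ :=
  ∫ t in {t : ℝ | (t : EReal) ∈ R}, Real.exp (-t)

/-- `R ⊆ (-∞,+∞]` is a finite union of disjoint intervals `(x,y]` with
`-∞ < x < y ≤ +∞`. -/
def IsFiniteUnionIoc (R : Set EReal) : Prop :=
  ∃ (m : ℕ) (w : Fin m → ℝ) (r : Fin m → EReal),
    (∀ l, (w l : EReal) < r l) ∧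
    (Pairwise fun l l' =>
      Disjoint (Set.Ioc (w l : EReal) (r l)) (Set.Ioc (w l' : EReal) (r l'))) ∧
    R = ⋃ l, Set.Ioc ((w l : ℝ) : EReal) (r l)

section RandomWalk

variable {d : ℕ}

/-- The uniform probability measure on the torus `(-π, π]^d`. -/
noncomputable def torusMeasure (d : ℕ) : Measure (Fin d → ℝ) :=
  Measure.pi fun _ => (ENNReal.ofReal (2 * π))⁻¹ • volume.restrict (Ioc (-π) π)

instance isProbabilityMeasure_circle : IsProbabilityMeasure
    ((ENNReal.ofReal (2 * π))⁻¹ • (volume : Measure ℝ).restrict (Ioc (-π) π)) := by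
  constructor
  have h : π - -π = 2 * π := by ring
  simp only [Measure.smul_apply, Measure.restrict_apply MeasurableSet.univ, univ_inter,
    Real.volume_Ioc, smul_eq_mul, h]
  exact ENNReal.inv_mul_cancel (by simp [pi_pos]) ENNReal.ofReal_ne_top

instance isProbabilityMeasure_torusMeasure : IsProbabilityMeasure (torusMeasure d) := by
  unfold torusMeasure; infer_instance

/-- The characteristic function of a step of the simple random walk. -/
noncomputable def stepChar (d : ℕ) (θ : Fin d → ℝ) : ℝ := (1 / d) * ∑ i, cos (θ i)

lemma abs_stepChar_le_average (θ : Fin d → ℝ) : |stepChar d θ| ≤ (1 / d) * ∑ i, |cos (θ i)| := by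
  unfold stepChar
  rw [abs_mul, abs_of_nonneg (by positivity)]
  gcongr
  exact Finset.abs_sum_le_sum_abs _ _

lemma abs_stepChar_le_one (θ : Fin d → ℝ) : |stepChar d θ| ≤ 1 := by
  refine (abs_stepChar_le_average θ).trans ?_
  have : ∑ i, |cos (θ i)| ≤ d := by
    calc ∑ i, |cos (θ i)| ≤ ∑ _i : Fin d, (1 : ℝ) :=
          Finset.sum_le_sum fun i _ => abs_cos_le_one _
      _ = d := by simp
  calc 1 / (d : ℝ) * ∑ i, |cos (θ i)| ≤ 1 / (d : ℝ) * d := by gcongr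
    _ ≤ 1 := by
      rw [one_div]; exact inv_mul_le_one

lemma continuous_stepChar : Continuous (stepChar d) := by
  unfold stepChar; fun_prop

lemma integral_circle_character (x : ℤ) :
    ∫ θ, Complex.exp (Complex.I * x * θ)
      ∂((ENNReal.ofReal (2 * π))⁻¹ • (volume : Measure ℝ).restrict (Ioc (-π) π))
      = if x = 0 then 1 else 0 := by
  rw [integral_smul_measure]
  split_ifs with h
  · subst h
    simp [pi_pos.le]
    field_simp
    norm_num
  · rw [← intervalIntegral.integral_of_le (by linarith [pi_pos])]
    have hx : (Complex.I * x : ℂ) ≠ 0 := by simp [h]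
    rw [integral_exp_mul_complex hx]
    have : Complex.exp (Complex.I * x * ((π : ℝ) : ℂ))
        = Complex.exp (Complex.I * x * ((-π : ℝ) : ℂ)) := by
      rw [Complex.exp_eq_exp_iff_exists_int]
      exact ⟨x, by push_cast; ring⟩
    rw [this]; simp

/-- The character `θ ↦ exp (i ⟨x, θ⟩)`. -/
noncomputable def torusChar (x : Zd d) (θ : Fin d → ℝ) : ℂ :=
  Complex.exp (∑ i, Complex.I * x i * θ i)

lemma norm_torusChar (x : Zd d) (θ : Fin d → ℝ) : ‖torusChar x θ‖ = 1 := by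
  have : ∑ i, Complex.I * x i * θ i = ((∑ i, (x i : ℝ) * θ i : ℝ) : ℂ) * Complex.I := by
    push_cast
    rw [Finset.sum_mul]
    exact Finset.sum_congr rfl fun i _ => by ring
  rw [torusChar, this, Complex.norm_exp_ofReal_mul_I]

lemma continuous_torusChar (x : Zd d) : Continuous (torusChar x) := by
  unfold torusChar; fun_prop

lemma integral_torusChar (x : Zd d) :
    ∫ θ, torusChar x θ ∂torusMeasure d = if x = 0 then 1 else 0 := by
  simp only [torusChar, Complex.exp_sum]
  rw [torusMeasure, integral_fintype_prod_eq_prod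
    (f := fun i (t : ℝ) => Complex.exp (Complex.I * x i * t))]
  simp only [integral_circle_character]
  rw [Finset.prod_ite_zero]
  simp [funext_iff]

lemma torusChar_rwStep (i : Fin d) (s : Bool) (a b : Zd d) (θ : Fin d → ℝ) :
    torusChar (rwStep d i s a - b) θ
      = torusChar (a - b) θ * Complex.exp (Complex.I * (if s then 1 else -1) * θ i) := by
  rw [torusChar, torusChar, ← Complex.exp_add]
  congr 1
  have : ∀ j, Complex.I * ((rwStep d i s a - b) j : ℤ) * θ j
      = Complex.I * ((a - b) j : ℤ) * θ j
        + (if j = i then Complex.I * (if s then 1 else -1) * θ i else 0) := by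
    intro j
    by_cases h : j = i
    · subst h
      cases s <;> simp [rwStep] <;> ring
    · simp [rwStep, h]
  rw [Finset.sum_congr rfl fun j _ => this j, Finset.sum_add_distrib]
  simp

lemma average_torusChar (a b : Zd d) (θ : Fin d → ℝ) :
    (1 / (2 * d) : ℂ) * ∑ i : Fin d, ∑ s : Bool, torusChar (rwStep d i s a - b) θ
      = torusChar (a - b) θ * stepChar d θ := by
  simp only [torusChar_rwStep, ← Finset.mul_sum]
  have : ∀ i : Fin d, ∑ s : Bool, Complex.exp (Complex.I * (if s then 1 else -1) * θ i)
      = 2 * Complex.cos (θ i) := by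
    intro i
    rw [Complex.two_cos]
    simp [mul_comm]
  rw [Finset.sum_congr rfl fun i _ => this i, ← Finset.mul_sum, stepChar]
  push_cast
  by_cases hd : (d : ℂ) = 0
  · simp [hd]
  · field_simp

lemma integrable_torusChar_mul_pow (x : Zd d) (m : ℕ) :
    Integrable (fun θ => torusChar x θ * (stepChar d θ : ℂ) ^ m) (torusMeasure d) := by
  refine Integrable.of_bound (C := 1) ?_ (ae_of_all _ fun θ => ?_)
  · exact ((continuous_torusChar x).mul
      ((Complex.continuous_ofReal.comp continuous_stepChar).pow m)).aestronglyMeasurable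
  · rw [norm_mul, norm_torusChar, one_mul, norm_pow, Complex.norm_real]
    exact pow_le_one₀ (norm_nonneg _) (abs_stepChar_le_one θ)

lemma rwP_eq_integral (m : ℕ) (a b : Zd d) :
    (rwP d m a b : ℂ) = ∫ θ, torusChar (a - b) θ * (stepChar d θ : ℂ) ^ m ∂torusMeasure d := by
  induction m generalizing a with
  | zero =>
    simp only [rwP, pow_zero, mul_one, integral_torusChar, sub_eq_zero]
    split_ifs <;> simp
  | succ m ih =>
    have : ∀ θ, torusChar (a - b) θ * (stepChar d θ : ℂ) ^ (m + 1)
        = (1 / (2 * d) : ℂ) * ∑ i : Fin d, ∑ s : Bool,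
          torusChar (rwStep d i s a - b) θ * (stepChar d θ : ℂ) ^ m := by
      intro θ
      simp only [← Finset.sum_mul]
      rw [← mul_assoc, average_torusChar]
      ring
    simp only [this]
    rw [integral_const_mul, integral_finsetSum]
    · simp only [rwP]
      push_cast
      congr 1
      refine Finset.sum_congr rfl fun i _ => ?_
      rw [integral_finsetSum]
      · exact Finset.sum_congr rfl fun s _ => ih _
      · exact fun s _ => integrable_torusChar_mul_pow _ _
    · exact fun i _ => integrable_finsetSum _ fun s _ => integrable_torusChar_mul_pow _ _

lemma rwP_nonneg (m : ℕ) (a b : Zd d) : 0 ≤ rwP d m a b := by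
  induction m generalizing a with
  | zero => simp only [rwP]; split_ifs <;> norm_num
  | succ m ih =>
    simp only [rwP]
    exact mul_nonneg (by positivity) (Finset.sum_nonneg fun i _ => Finset.sum_nonneg fun s _ => ih _)

lemma rwP_translate (m : ℕ) (a b a' b' : Zd d) (h : a - b = a' - b') :
    rwP d m a b = rwP d m a' b' := by
  have := rwP_eq_integral m a b
  rw [h, ← rwP_eq_integral] at this
  exact_mod_cast this

lemma rwP_comm (m : ℕ) (a b : Zd d) : rwP d m a b = rwP d m b a := by
  have h : (starRingEnd ℂ) (rwP d m a b : ℂ) = rwP d m b a := by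
    rw [rwP_eq_integral, ← integral_conj, rwP_eq_integral]
    congr 1
    ext θ
    rw [map_mul, map_pow, Complex.conj_ofReal, torusChar, torusChar, ← Complex.exp_conj]
    congr 2
    simp only [map_sum, map_mul, Complex.conj_I, Complex.conj_ofReal, map_intCast, Pi.sub_apply]
    refine Finset.sum_congr rfl fun i _ => ?_
    push_cast
    ring
  rw [Complex.conj_ofReal] at h
  exact_mod_cast h

lemma rwP_le_integral (m : ℕ) (a b : Zd d) :
    rwP d m a b ≤ ∫ θ, |stepChar d θ| ^ m ∂torusMeasure d := by
  have h : rwP d m a b = ‖(rwP d m a b : ℂ)‖ := by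
    rw [Complex.norm_real, Real.norm_of_nonneg (rwP_nonneg m a b)]
  rw [h, rwP_eq_integral]
  refine (norm_integral_le_integral_norm _).trans (le_of_eq ?_)
  congr 1
  ext θ
  simp [norm_torusChar]

lemma rwP_eq_zero_of_lt (m : ℕ) (a b : Zd d) (i : Fin d) (h : (m : ℤ) < |a i - b i|) :
    rwP d m a b = 0 := by
  induction m generalizing a with
  | zero =>
    have : a ≠ b := by rintro rfl; simp at h
    simp [rwP, this]
  | succ m ih =>
    simp only [rwP]
    refine mul_eq_zero_of_right _ (Finset.sum_eq_zero fun j _ => Finset.sum_eq_zero fun s _ => ?_)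
    apply ih
    have h1 : |rwStep d j s a i - a i| ≤ 1 := by
      by_cases hj : i = j
      · subst hj; cases s <;> simp [rwStep]
      · simp [rwStep, hj]
    have h2 := abs_sub_abs_le_abs_sub (a i - b i) (rwStep d j s a i - b i)
    have h3 : |(a i - b i) - (rwStep d j s a i - b i)| = |rwStep d j s a i - a i| := by
      rw [abs_sub_comm]; congr 1; ring
    push_cast at h
    linarith

end RandomWalk

section HeatKernel

variable {d : ℕ}

lemma exp_neg_one_sub_abs_cos_le {t : ℝ} (ht : 0 ≤ t) {x θ : ℝ} (hx : |x| ≤ π / 2)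
    (h : |sin θ| = |sin x|) :
    exp (-(t * (1 - |cos θ|))) ≤ exp (-(2 * t / π ^ 2) * x ^ 2) := by
  apply exp_le_exp.2
  have h1 : 1 - |cos θ| ≥ sin θ ^ 2 / 2 := by
    have := sin_sq_add_cos_sq θ
    have h2 := sq_abs (cos θ)
    nlinarith [abs_nonneg (cos θ), abs_cos_le_one θ, sq_nonneg (1 - |cos θ|)]
  have h2 : (2 / π * |x|) ^ 2 ≤ sin θ ^ 2 := by
    rw [← sq_abs (sin θ), h]
    exact pow_le_pow_left₀ (by positivity) (mul_abs_le_abs_sin hx) 2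
  rw [mul_pow, sq_abs] at h2
  have h3 : (2 * t / π ^ 2) * x ^ 2 = t * (((2 / π) ^ 2 * x ^ 2) / 2) := by
    field_simp
  have : t * (((2 / π) ^ 2 * x ^ 2) / 2) ≤ t * (1 - |cos θ|) :=
    mul_le_mul_of_nonneg_left (by linarith) ht
  linarith

lemma integral_circle_exp_le {t : ℝ} (ht : 0 < t) :
    ∫ θ, exp (-(t * (1 - |cos θ|)))
      ∂((ENNReal.ofReal (2 * π))⁻¹ • (volume : Measure ℝ).restrict (Ioc (-π) π))
      ≤ 4 / sqrt t := by
  have hc : 0 < 2 * t / π ^ 2 := by positivity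
  set c := 2 * t / π ^ 2 with hcdef
  have hi : Integrable fun x : ℝ => exp (-c * x ^ 2) := integrable_exp_neg_mul_sq hc
  have hi1 : Integrable fun x : ℝ => exp (-c * (x - π) ^ 2) := hi.comp_sub_right π
  have hi2 : Integrable fun x : ℝ => exp (-c * (x + π) ^ 2) := hi.comp_add_right π
  have hle : ∫ θ in Ioc (-π) π, exp (-(t * (1 - |cos θ|)))
      ≤ ∫ θ, (exp (-c * θ ^ 2) + exp (-c * (θ - π) ^ 2) + exp (-c * (θ + π) ^ 2)) := by
    refine le_trans ?_ (setIntegral_le_integral (s := Ioc (-π) π) ((hi.add hi1).add hi2)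
      (ae_of_all _ fun θ => by simp only [Pi.zero_apply]; positivity))
    refine setIntegral_mono_on ?_ ((hi.add hi1).add hi2).integrableOn measurableSet_Ioc ?_
    · exact Continuous.integrableOn_Ioc (by fun_prop)
    · intro θ hθ
      have p1 := exp_pos (-c * θ ^ 2)
      have p2 := exp_pos (-c * (θ - π) ^ 2)
      have p3 := exp_pos (-c * (θ + π) ^ 2)
      rcases le_or_gt |θ| (π / 2) with h | h
      · have := exp_neg_one_sub_abs_cos_le ht.le h rfl
        linarith
      · rcases lt_abs.1 h with h | h
        · have := exp_neg_one_sub_abs_cos_le ht.le (x := θ - π) (θ := θ)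
            (abs_le.2 ⟨by linarith, by linarith [hθ.2, pi_pos]⟩) (by rw [sin_sub_pi, abs_neg])
          linarith
        · have := exp_neg_one_sub_abs_cos_le ht.le (x := θ + π) (θ := θ)
            (abs_le.2 ⟨by linarith [hθ.1, pi_pos], by linarith⟩) (by rw [sin_add_pi, abs_neg])
          linarith
  have e1 : ∫ θ : ℝ, exp (-c * (θ - π) ^ 2) = sqrt (π / c) := by
    rw [integral_sub_right_eq_self (fun x : ℝ => exp (-c * x ^ 2)), integral_gaussian]
  have e2 : ∫ θ : ℝ, exp (-c * (θ + π) ^ 2) = sqrt (π / c) := by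
    rw [integral_add_right_eq_self (fun x : ℝ => exp (-c * x ^ 2)), integral_gaussian]
  have hsum : ∫ θ, (exp (-c * θ ^ 2) + exp (-c * (θ - π) ^ 2) + exp (-c * (θ + π) ^ 2))
      = 3 * sqrt (π / c) := by
    have h12 := integral_add (hi.add hi1) hi2
    simp only [Pi.add_apply] at h12
    rw [h12, integral_add hi hi1, integral_gaussian, e1, e2]
    ring
  rw [hsum] at hle
  rw [integral_smul_measure, ENNReal.toReal_inv, ENNReal.toReal_ofReal (by positivity),
    smul_eq_mul]
  have h4 : sqrt (π / c) ≤ π * 2 / sqrt t := by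
    rw [show π * 2 / sqrt t = sqrt ((π * 2) ^ 2 / t) by
      rw [sqrt_div' _ ht.le, sqrt_sq (by positivity)]]
    apply sqrt_le_sqrt
    rw [hcdef]
    have : π / (2 * t / π ^ 2) = π ^ 2 * (π / 2) / t := by field_simp
    rw [this]
    gcongr
    nlinarith [pi_le_four, pi_pos, sq_nonneg π]
  calc (2 * π)⁻¹ * ∫ θ in Ioc (-π) π, exp (-(t * (1 - |cos θ|)))
      ≤ (2 * π)⁻¹ * (3 * (π * 2 / sqrt t)) := by gcongr; linarith
    _ = 3 / sqrt t := by field_simp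
    _ ≤ 4 / sqrt t := by gcongr; norm_num

lemma abs_stepChar_pow_le (hd : 0 < d) (m : ℕ) (θ : Fin d → ℝ) :
    |stepChar d θ| ^ m ≤ ∏ i, exp (-((m / d : ℝ) * (1 - |cos (θ i)|))) := by
  have hd' : (0 : ℝ) < d := by exact_mod_cast hd
  have h1 : |stepChar d θ| ≤ exp ((1 / d) * ∑ i, |cos (θ i)| - 1) := by
    have := add_one_le_exp ((1 / d) * ∑ i, |cos (θ i)| - 1)
    linarith [abs_stepChar_le_average θ]
  refine (pow_le_pow_left₀ (abs_nonneg _) h1 m).trans (le_of_eq ?_)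
  rw [← exp_nat_mul, ← exp_sum]
  congr 1
  rw [Finset.sum_neg_distrib, ← Finset.mul_sum, Finset.sum_sub_distrib]
  simp
  field_simp
  ring

lemma integral_abs_stepChar_pow_le (hd : 3 ≤ d) {m : ℕ} (hm : 0 < m) :
    ∫ θ, |stepChar d θ| ^ m ∂torusMeasure d ≤ (4 * sqrt d / sqrt m) ^ 3 := by
  have hd' : (0 : ℝ) < d := by exact_mod_cast (show 0 < d by omega)
  have hm' : (0 : ℝ) < m := by exact_mod_cast hm
  set I := ∫ θ, exp (-((m / d : ℝ) * (1 - |cos θ|)))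
      ∂((ENNReal.ofReal (2 * π))⁻¹ • (volume : Measure ℝ).restrict (Ioc (-π) π)) with hI
  have hI0 : 0 ≤ I := integral_nonneg fun θ => (exp_pos _).le
  have hIb : I ≤ 4 / sqrt (m / d) := integral_circle_exp_le (by positivity)
  have hle1 : ∀ θ, exp (-((m / d : ℝ) * (1 - |cos θ|))) ≤ 1 := fun θ => by
    apply exp_le_one_iff.2
    have := abs_cos_le_one θ
    have : 0 ≤ (m / d : ℝ) * (1 - |cos θ|) := mul_nonneg (by positivity) (by linarith)
    linarith
  have hI1 : I ≤ 1 := by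
    have := integral_mono_of_nonneg (μ := (ENNReal.ofReal (2 * π))⁻¹ •
      (volume : Measure ℝ).restrict (Ioc (-π) π)) (f := fun θ =>
        exp (-((m / d : ℝ) * (1 - |cos θ|)))) (g := fun _ => (1 : ℝ))
      (ae_of_all _ fun θ => (exp_pos _).le) (integrable_const _) (ae_of_all _ hle1)
    rwa [integral_const, probReal_univ, one_smul] at this
  have hprod : ∫ θ, ∏ i, exp (-((m / d : ℝ) * (1 - |cos (θ i)|))) ∂torusMeasure d = I ^ d := by
    rw [torusMeasure, integral_fintype_prod_eq_prod
      (f := fun _ (t : ℝ) => exp (-((m / d : ℝ) * (1 - |cos t|))))]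
    simp [hI]
  calc ∫ θ, |stepChar d θ| ^ m ∂torusMeasure d
      ≤ ∫ θ, ∏ i, exp (-((m / d : ℝ) * (1 - |cos (θ i)|))) ∂torusMeasure d := by
        refine integral_mono_of_nonneg (ae_of_all _ fun θ => by positivity) ?_
          (ae_of_all _ fun θ => abs_stepChar_pow_le (by omega) m θ)
        refine Integrable.of_bound (C := 1) ?_ (ae_of_all _ fun θ => ?_)
        · exact Continuous.aestronglyMeasurable (by fun_prop)
        · rw [Real.norm_of_nonneg (Finset.prod_nonneg fun i _ => (exp_pos _).le)]
          exact Finset.prod_le_one (fun i _ => (exp_pos _).le) fun i _ => hle1 _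
    _ = I ^ d := hprod
    _ ≤ I ^ 3 := pow_le_pow_of_le_one hI0 hI1 hd
    _ ≤ (4 * sqrt d / sqrt m) ^ 3 := by
        refine pow_le_pow_left₀ hI0 (hIb.trans (le_of_eq ?_)) 3
        rw [sqrt_div hm'.le]
        field_simp

/-- The constant in the heat kernel bound `rwP_add_le`. -/
noncomputable def heatConst (d : ℕ) : ℝ := (4 * sqrt d) ^ 3

lemma rwP_add_le (hd : 3 ≤ d) {L : ℕ} (hL : 0 < L) (m : ℕ) (a b : Zd d) :
    rwP d (L + m) a b
      ≤ heatConst d * (L : ℝ) ^ (-(1 / 4) : ℝ) * ((m + 1 : ℕ) : ℝ) ^ (-(5 / 4) : ℝ) := by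
  have hL' : (1 : ℝ) ≤ L := by exact_mod_cast hL
  refine (rwP_le_integral _ a b).trans ((integral_abs_stepChar_pow_le hd (by omega)).trans ?_)
  have hpos : (0 : ℝ) < ((L + m : ℕ) : ℝ) := by exact_mod_cast (show 0 < L + m by omega)
  rw [div_pow, mul_assoc, heatConst, div_eq_mul_inv]
  gcongr
  have h1 : (sqrt ((L + m : ℕ) : ℝ) ^ 3)⁻¹
      = ((L + m : ℕ) : ℝ) ^ (-(1 / 4) : ℝ) * ((L + m : ℕ) : ℝ) ^ (-(5 / 4) : ℝ) := by
    rw [← rpow_add hpos, sqrt_eq_rpow, ← rpow_natCast, ← rpow_mul hpos.le, ← rpow_neg hpos.le]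
    norm_num
  rw [h1]
  gcongr ?_ * ?_
  · apply rpow_le_rpow_of_nonpos (by linarith) (by push_cast; linarith [m.cast_nonneg (α := ℝ)])
    norm_num
  · apply rpow_le_rpow_of_nonpos (by positivity) (by push_cast; linarith)
    norm_num

lemma summable_heat_tail : Summable fun m : ℕ => ((m + 1 : ℕ) : ℝ) ^ (-(5 / 4) : ℝ) :=
  (summable_nat_add_iff 1).2 (Real.summable_nat_rpow.2 (by norm_num))

/-- The tail `∑_{m ≥ L} p_m(a,b)` of the Green's function. -/
noncomputable def greenTail (d L : ℕ) (a b : Zd d) : ℝ := ∑' m, rwP d (L + m) a b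

lemma summable_rwP (hd : 3 ≤ d) (L : ℕ) (a b : Zd d) : Summable fun m => rwP d (L + m) a b := by
  have h : Summable fun m => rwP d (1 + m) a b :=
    Summable.of_nonneg_of_le (fun m => rwP_nonneg _ a b) (fun m => rwP_add_le hd one_pos m a b)
      (summable_heat_tail.mul_left _)
  have h0 : Summable fun m => rwP d m a b := by
    refine (summable_nat_add_iff 1).1 ?_
    simpa only [add_comm] using h
  simpa only [add_comm] using (summable_nat_add_iff L).2 h0

lemma greenTail_zero (a b : Zd d) : greenTail d 0 a b = green d a b := by
  simp [greenTail, green]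

lemma greenTail_nonneg (L : ℕ) (a b : Zd d) : 0 ≤ greenTail d L a b :=
  tsum_nonneg fun _ => rwP_nonneg _ a b

lemma greenTail_eq_add (hd : 3 ≤ d) (L : ℕ) (a b : Zd d) :
    greenTail d L a b = rwP d L a b + greenTail d (L + 1) a b := by
  rw [greenTail, (summable_rwP hd L a b).tsum_eq_zero_add, greenTail, add_zero]
  congr 2
  ext m
  congr 1
  ring

lemma greenTail_succ (hd : 3 ≤ d) (L : ℕ) (a b : Zd d) :
    greenTail d (L + 1) a b
      = (1 / (2 * d)) * ∑ i : Fin d, ∑ s : Bool, greenTail d L (rwStep d i s a) b := by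
  have : ∀ m, rwP d (L + 1 + m) a b
      = (1 / (2 * d)) * ∑ i : Fin d, ∑ s : Bool, rwP d (L + m) (rwStep d i s a) b := by
    intro m
    rw [show L + 1 + m = (L + m) + 1 by ring, rwP]
  simp only [greenTail, this]
  rw [tsum_mul_left, Summable.tsum_finsetSum]
  · congr 1
    refine Finset.sum_congr rfl fun i _ => ?_
    rw [Summable.tsum_finsetSum]
    exact fun s _ => summable_rwP hd L _ b
  · exact fun i _ => summable_sum fun s _ => summable_rwP hd L _ b

lemma greenTail_comm (L : ℕ) (a b : Zd d) : greenTail d L a b = greenTail d L b a := by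
  simp only [greenTail, rwP_comm _ a b]

lemma greenTail_self (L : ℕ) (a : Zd d) : greenTail d L a a = greenTail d L 0 0 := by
  simp only [greenTail, rwP_translate _ a a 0 0 (by simp)]

/-- The constant in the bound `greenTail_le`. -/
noncomputable def greenTailConst (d : ℕ) : ℝ :=
  heatConst d * ∑' m : ℕ, ((m + 1 : ℕ) : ℝ) ^ (-(5 / 4) : ℝ)

lemma greenTail_le (hd : 3 ≤ d) {L : ℕ} (hL : 0 < L) (a b : Zd d) :
    greenTail d L a b ≤ greenTailConst d * (L : ℝ) ^ (-(1 / 4) : ℝ) := by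
  have := (summable_rwP hd L a b).tsum_le_tsum (fun m => rwP_add_le hd hL m a b)
    (summable_heat_tail.mul_left _)
  rw [tsum_mul_left] at this
  rw [greenTail, greenTailConst]
  linarith

lemma greenTail_eq_green_of_far (hd : 3 ≤ d) (L : ℕ) (a b : Zd d) (i : Fin d)
    (h : (L : ℤ) ≤ |a i - b i|) : greenTail d L a b = green d a b := by
  induction L with
  | zero => exact greenTail_zero a b
  | succ L ih =>
    push_cast at h
    rw [← ih (by linarith), greenTail_eq_add hd L, rwP_eq_zero_of_lt L a b i (by linarith),
      zero_add]

lemma one_le_green (hd : 3 ≤ d) : 1 ≤ green d 0 0 := by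
  rw [← greenTail_zero, greenTail_eq_add hd]
  have := greenTail_nonneg (0 + 1) (0 : Zd d) 0
  simp only [rwP, if_true]
  linarith

end HeatKernel

open scoped NNReal

section Field

variable {d : ℕ} {Ω : Type*} [MeasurableSpace Ω] {P : Measure Ω} {φ : Zd d → Ω → ℝ}

namespace IsGaussianField

variable {G : Zd d → Zd d → ℝ}

lemma measurable_of_mem_span (hφ : IsGaussianField P d G φ) {Z : Ω → ℝ}
    (hZ : Z ∈ Submodule.span ℝ (Set.range φ)) : Measurable Z := by
  induction hZ using Submodule.span_induction with
  | mem x h => obtain ⟨a, rfl⟩ := h; exact hφ.1 a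
  | zero => exact measurable_const
  | add x y _ _ hx hy => exact hx.add hy
  | smul c x _ hx => exact hx.const_mul c

lemma exists_map_eq_of_mem_span (hφ : IsGaussianField P d G φ) {Z : Ω → ℝ}
    (hZ : Z ∈ Submodule.span ℝ (Set.range φ)) : ∃ v : ℝ≥0, P.map Z = gaussianReal 0 v := by
  obtain ⟨c, rfl⟩ := Finsupp.mem_span_range_iff_exists_finsupp.1 hZ
  refine ⟨_, Eq.trans ?_ (hφ.2 c)⟩
  congr 1
  ext ω
  simp [Finsupp.sum]

lemma hasGaussianLaw_of_mem_span (hφ : IsGaussianField P d G φ) {Z : Ω → ℝ}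
    (hZ : Z ∈ Submodule.span ℝ (Set.range φ)) : HasGaussianLaw Z P := by
  obtain ⟨v, hv⟩ := hφ.exists_map_eq_of_mem_span hZ
  exact ⟨by rw [hv]; infer_instance⟩

lemma memLp_of_mem_span (hφ : IsGaussianField P d G φ) {Z : Ω → ℝ}
    (hZ : Z ∈ Submodule.span ℝ (Set.range φ)) : MemLp Z 2 P :=
  (hφ.hasGaussianLaw_of_mem_span hZ).memLp_two

lemma map_eq_of_mem_span (hφ : IsGaussianField P d G φ) {Z : Ω → ℝ}
    (hZ : Z ∈ Submodule.span ℝ (Set.range φ)) :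
    P.map Z = gaussianReal 0 (Var[Z; P]).toNNReal := by
  obtain ⟨v, hv⟩ := hφ.exists_map_eq_of_mem_span hZ
  have h : Var[Z; P] = v := by
    have := variance_map (X := id) (Y := Z) (μ := P) aemeasurable_id
      (hφ.measurable_of_mem_span hZ).aemeasurable
    rw [hv, variance_id_gaussianReal] at this
    simpa using this.symm
  rw [hv, h, Real.toNNReal_coe]

lemma isGaussianProcess_of_mem_span (hφ : IsGaussianField P d G φ) {T : Type*}
    {X : T → Ω → ℝ} (hX : ∀ t, X t ∈ Submodule.span ℝ (Set.range φ)) :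
    IsGaussianProcess X P := by
  classical
  refine ⟨fun I => ⟨isGaussian_of_map_eq_gaussianReal fun L => ?_⟩⟩
  have hmeas : Measurable fun ω => I.restrict (X · ω) :=
    measurable_pi_lambda _ fun i => hφ.measurable_of_mem_span (hX i)
  rw [Measure.map_map (by fun_prop) hmeas]
  have : (L ∘ fun ω => I.restrict (X · ω)) = ∑ i : I, L (Pi.single i 1) • X i := by
    ext ω
    have h := L.toLinearMap.pi_apply_eq_sum_univ (I.restrict (X · ω))
    simp only [Function.comp_apply, Finset.sum_apply, Pi.smul_apply, smul_eq_mul]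
    refine h.trans (Finset.sum_congr rfl fun i _ => ?_)
    rw [smul_eq_mul, mul_comm]
    have hs : (fun j => if i = j then (1 : ℝ) else 0) = Pi.single i 1 := by
      funext j
      simp [Pi.single_apply, eq_comm]
    rw [hs]
    rfl
  rw [this]
  obtain ⟨v, hv⟩ := hφ.exists_map_eq_of_mem_span
    (Submodule.sum_mem _ (t := Finset.univ) fun (i : I) _ =>
      Submodule.smul_mem _ (L (Pi.single i 1)) (hX i))
  exact ⟨0, v, hv⟩

lemma measureReal_ge_le (hφ : IsGaussianField P d G φ) {Z : Ω → ℝ}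
    (hZ : Z ∈ Submodule.span ℝ (Set.range φ)) {c t : ℝ} (hc : Var[Z; P] ≤ c) (ht : 0 ≤ t) :
    P.real {ω | t ≤ Z ω} ≤ exp (-t ^ 2 / (2 * c)) := by
  have hmap := hφ.map_eq_of_mem_span hZ
  have hc0 : 0 ≤ c := (variance_nonneg _ _).trans hc
  have hsub : HasSubgaussianMGF Z c.toNNReal P := by
    refine ⟨fun s => ?_, fun s => ?_⟩
    · have := integrable_exp_mul_gaussianReal (μ := 0) (v := (Var[Z; P]).toNNReal) s
      rw [← hmap, integrable_map_measure (by fun_prop)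
        (hφ.measurable_of_mem_span hZ).aemeasurable] at this
      exact this
    · rw [mgf_gaussianReal hmap, Real.coe_toNNReal _ (variance_nonneg _ _), Real.coe_toNNReal _ hc0]
      apply exp_le_exp.2
      rw [zero_mul, zero_add]
      gcongr
  have := hsub.measure_ge_le ht
  rwa [Real.coe_toNNReal _ hc0] at this

lemma measureReal_abs_ge_le (hφ : IsGaussianField P d G φ) [IsProbabilityMeasure P] {Z : Ω → ℝ}
    (hZ : Z ∈ Submodule.span ℝ (Set.range φ)) {c t : ℝ} (hc : Var[Z; P] ≤ c) (ht : 0 ≤ t) :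
    P.real {ω | t ≤ |Z ω|} ≤ 2 * exp (-t ^ 2 / (2 * c)) := by
  have h1 := hφ.measureReal_ge_le hZ hc ht
  have h2 := hφ.measureReal_ge_le (Submodule.neg_mem _ hZ) (c := c)
    (by rwa [variance_neg]) ht
  have : {ω | t ≤ |Z ω|} ⊆ {ω | t ≤ Z ω} ∪ {ω | t ≤ (-Z) ω} := fun ω hω => by
    simpa [le_abs] using hω
  calc P.real {ω | t ≤ |Z ω|} ≤ P.real ({ω | t ≤ Z ω} ∪ {ω | t ≤ (-Z) ω}) :=
        measureReal_mono this
    _ ≤ _ := (measureReal_union_le _ _).trans (by linarith)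

end IsGaussianField

/-- The average of the field `φ` over the position at time `L` of a random walk started at `a`. -/
noncomputable def walkAverage (φ : Zd d → Ω → ℝ) : ℕ → Zd d → Ω → ℝ
  | 0, a => φ a
  | (L + 1), a => (1 / (2 * d) : ℝ) • ∑ i : Fin d, ∑ s : Bool, walkAverage φ L (rwStep d i s a)

omit [MeasurableSpace Ω] in
lemma walkAverage_mem_span (L : ℕ) (a : Zd d) :
    walkAverage φ L a ∈ Submodule.span ℝ (Set.range φ) := by
  induction L generalizing a with
  | zero => exact Submodule.subset_span ⟨a, rfl⟩
  | succ L ih =>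
    exact Submodule.smul_mem _ _ (Submodule.sum_mem _ fun i _ => Submodule.sum_mem _ fun s _ => ih _)

omit [MeasurableSpace Ω] in
lemma field_mem_span (a : Zd d) : φ a ∈ Submodule.span ℝ (Set.range φ) :=
  Submodule.subset_span ⟨a, rfl⟩

namespace IsGaussianField

variable [IsProbabilityMeasure P]

omit [IsProbabilityMeasure P] in
lemma variance_eq (hφ : IsGaussianField P d (green d) φ) (hd : 3 ≤ d) (a : Zd d) :
    Var[φ a; P] = green d 0 0 := by
  have h := hφ.2 (Finsupp.single a 1)
  rw [Finsupp.support_single _ one_ne_zero] at h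
  simp only [Finset.sum_singleton, Finsupp.single_eq_same, one_mul] at h
  have h2 := variance_map (X := id) (Y := φ a) (μ := P) aemeasurable_id (hφ.1 a).aemeasurable
  have h3 : green d a a = green d 0 0 := by
    rw [← greenTail_zero, greenTail_self, greenTail_zero]
  rw [h, variance_id_gaussianReal, h3, Real.coe_toNNReal _ (by linarith [one_le_green hd])] at h2
  simpa using h2.symm

omit [IsProbabilityMeasure P] in
lemma variance_add_eq (hφ : IsGaussianField P d (green d) φ) (hd : 3 ≤ d) {a b : Zd d}
    (hab : a ≠ b) : Var[φ a + φ b; P] = 2 * green d 0 0 + 2 * green d a b := by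
  have h := hφ.2 (Finsupp.single a 1 + Finsupp.single b 1)
  have hs : (Finsupp.single a (1 : ℝ) + Finsupp.single b 1).support = {a, b} := by
    rw [Finsupp.support_add_eq, Finsupp.support_single _ one_ne_zero,
      Finsupp.support_single _ one_ne_zero]
    · rfl
    · rw [Finsupp.support_single _ one_ne_zero,
        Finsupp.support_single _ one_ne_zero]
      simpa using hab
  rw [hs] at h
  simp only [Finset.sum_pair hab, Finsupp.add_apply, Finsupp.single_eq_same,
    Finsupp.single_eq_of_ne hab, Finsupp.single_eq_of_ne hab.symm, one_mul, add_zero, zero_add] at h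
  have hself : ∀ a : Zd d, green d a a = green d 0 0 := fun a => by
    rw [← greenTail_zero, greenTail_self, greenTail_zero]
  have hcomm : green d b a = green d a b := by
    rw [← greenTail_zero, greenTail_comm, greenTail_zero]
  have hnn : 0 ≤ green d a b := by
    rw [← greenTail_zero]; exact greenTail_nonneg _ _ _
  have h2 := variance_map (X := id) (Y := φ a + φ b) (μ := P) aemeasurable_id
    ((hφ.1 a).add (hφ.1 b)).aemeasurable
  have h' : P.map (φ a + φ b) = _ := h
  rw [h', variance_id_gaussianReal, hself a, hself b, hcomm,
    Real.coe_toNNReal _ (by linarith [one_le_green hd])] at h2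
  rw [show id ∘ (φ a + φ b) = φ a + φ b from rfl] at h2
  linarith

lemma covariance_eq (hφ : IsGaussianField P d (green d) φ) (hd : 3 ≤ d) (a b : Zd d) :
    cov[φ a, φ b; P] = green d a b := by
  by_cases hab : a = b
  · subst hab
    rw [covariance_self (hφ.1 a).aemeasurable, hφ.variance_eq hd, ← greenTail_zero,
      ← greenTail_zero, greenTail_self 0 a]
  · have h := variance_add (hφ.memLp_of_mem_span (field_mem_span a))
      (hφ.memLp_of_mem_span (field_mem_span b))
    rw [hφ.variance_add_eq hd hab, hφ.variance_eq hd, hφ.variance_eq hd] at h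
    linarith

lemma covariance_walkAverage_left (hφ : IsGaussianField P d (green d) φ) {L : ℕ} {a : Zd d}
    {Z : Ω → ℝ} (hZ : Z ∈ Submodule.span ℝ (Set.range φ)) :
    cov[walkAverage φ (L + 1) a, Z; P] = (1 / (2 * d)) * ∑ i : Fin d, ∑ s : Bool,
      cov[walkAverage φ L (rwStep d i s a), Z; P] := by
  have hZ2 := hφ.memLp_of_mem_span hZ
  rw [walkAverage, covariance_smul_left, covariance_sum_left _ hZ2]
  · congr 1
    refine Finset.sum_congr rfl fun i _ => ?_
    rw [covariance_sum_left _ hZ2]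
    exact fun s => hφ.memLp_of_mem_span (walkAverage_mem_span _ _)
  · exact fun i => hφ.memLp_of_mem_span
      (Submodule.sum_mem _ fun s _ => walkAverage_mem_span _ _)

lemma covariance_walkAverage (hφ : IsGaussianField P d (green d) φ) (hd : 3 ≤ d) (L M : ℕ)
    (a b : Zd d) : cov[walkAverage φ L a, walkAverage φ M b; P] = greenTail d (L + M) a b := by
  have h0 : ∀ (L : ℕ) (a b : Zd d), cov[walkAverage φ L a, φ b; P] = greenTail d L a b := by
    intro L
    induction L with
    | zero => intro a b; rw [greenTail_zero]; exact hφ.covariance_eq hd a b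
    | succ L ih =>
      intro a b
      rw [hφ.covariance_walkAverage_left (field_mem_span b), greenTail_succ hd]
      simp only [ih]
  induction L generalizing a with
  | zero =>
    rw [covariance_comm, zero_add, greenTail_comm]
    exact h0 M b a
  | succ L ih =>
    rw [hφ.covariance_walkAverage_left (walkAverage_mem_span M b),
      show L + 1 + M = (L + M) + 1 by ring, greenTail_succ hd]
    simp only [ih]

lemma variance_walkAverage_le (hφ : IsGaussianField P d (green d) φ) (hd : 3 ≤ d) {L : ℕ}
    (hL : 0 < L) (a : Zd d) :
    Var[walkAverage φ L a; P] ≤ greenTailConst d * (L : ℝ) ^ (-(1 / 4) : ℝ) := by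
  rw [← covariance_self (hφ.measurable_of_mem_span (walkAverage_mem_span L a)).aemeasurable,
    hφ.covariance_walkAverage hd]
  refine le_trans ?_ (greenTail_le hd hL a a)
  have h : ∀ M, greenTail d (L + M) a a ≤ greenTail d L a a := by
    intro M
    induction M with
    | zero => exact le_rfl
    | succ M ih =>
      have := greenTail_eq_add hd (L + M) a a
      have := rwP_nonneg (L + M) a a
      rw [← add_assoc]
      linarith
  exact h L

lemma green_le_sub_half (hφ : IsGaussianField P d (green d) φ) (hd : 3 ≤ d) {a b : Zd d}
    (hab : a ≠ b) : green d a b ≤ green d 0 0 - 1 / 2 := by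
  have hm := fun c : Zd d => hφ.memLp_of_mem_span (field_mem_span c)
  have hmw := hφ.memLp_of_mem_span (walkAverage_mem_span 1 a)
  have h := variance_sub hmw (hm b)
  have h0 : 0 ≤ Var[walkAverage φ 1 a - φ b; P] := variance_nonneg _ _
  have h1 : Var[walkAverage φ 1 a; P] = greenTail d 2 a a := by
    rw [← covariance_self hmw.aemeasurable, hφ.covariance_walkAverage hd]
  have h2 : cov[walkAverage φ 1 a, φ b; P] = greenTail d 1 a b :=
    hφ.covariance_walkAverage hd 1 0 a b
  rw [h, h1, h2, hφ.variance_eq hd] at h0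
  have e1 := greenTail_eq_add hd 0 a a
  have e2 := greenTail_eq_add hd 1 a a
  have e3 := greenTail_eq_add hd 0 a b
  have e4 := rwP_nonneg 1 a a
  have e5 := greenTail_self 0 a
  rw [greenTail_zero] at e3
  rw [greenTail_zero 0 0] at e5
  simp only [rwP, if_neg hab, if_true] at e1 e3
  linarith

lemma variance_add_le (hφ : IsGaussianField P d (green d) φ) (hd : 3 ≤ d) {a b : Zd d}
    (hab : a ≠ b) : Var[φ a + φ b; P] ≤ 4 * green d 0 0 - 1 := by
  rw [hφ.variance_add_eq hd hab]
  linarith [hφ.green_le_sub_half hd hab]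

lemma indepFun_sub_walkAverage (hφ : IsGaussianField P d (green d) φ) (hd : 3 ≤ d) (L : ℕ)
    (a : Zd d) (U : Set (Zd d)) (hU : ∀ b ∈ U, ∃ i, (L : ℤ) ≤ |a i - b i|) :
    IndepFun (φ a - walkAverage φ L a) (fun ω (b : U) => φ b ω) P := by
  have hX : φ a - walkAverage φ L a ∈ Submodule.span ℝ (Set.range φ) :=
    Submodule.sub_mem _ (field_mem_span a) (walkAverage_mem_span L a)
  have hproc : IsGaussianProcess
      (Sum.elim (fun _ : Unit => φ a - walkAverage φ L a) (fun b : U => φ b)) P := by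
    refine hφ.isGaussianProcess_of_mem_span fun t => ?_
    rcases t with t | t
    · exact hX
    · exact field_mem_span _
  have h := hproc.indepFun_of_covariance_eq_zero
    (fun _ => (hφ.measurable_of_mem_span hX).aemeasurable)
    (fun b => (hφ.1 b).aemeasurable) fun _ b => by
      obtain ⟨i, hi⟩ := hU b b.2
      have h2 : cov[walkAverage φ L a, φ b; P] = greenTail d L a b :=
        hφ.covariance_walkAverage hd L 0 a b
      rw [covariance_sub_left (hφ.memLp_of_mem_span (field_mem_span a))
        (hφ.memLp_of_mem_span (walkAverage_mem_span L a))
        (hφ.memLp_of_mem_span (field_mem_span _)), hφ.covariance_eq hd, h2,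
        greenTail_eq_green_of_far hd L a b i hi, sub_self]
  exact h.comp (φ := fun f : Unit → ℝ => f ()) (ψ := id) (measurable_pi_apply ()) measurable_id

end IsGaussianField

end Field

section PoissonApproximation

variable {Ω : Type*} [MeasurableSpace Ω] {P : Measure Ω} [IsProbabilityMeasure P]

lemma measureReal_sub_sum_le_inter_biInter_compl {ι : Type*} [DecidableEq ι] (A : ι → Set Ω)
    (C : Set Ω) (S T : Finset ι) :
    P.real (C ∩ ⋂ j ∈ S \ T, (A j)ᶜ) - ∑ j ∈ S ∩ T, P.real (C ∩ A j) ≤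
      P.real (C ∩ ⋂ j ∈ S, (A j)ᶜ) := by
  have h : C ∩ ⋂ j ∈ S \ T, (A j)ᶜ ⊆ (C ∩ ⋂ j ∈ S, (A j)ᶜ) ∪ ⋃ j ∈ S ∩ T, C ∩ A j := by
    rintro ω ⟨hC, hω⟩
    by_cases h : ∃ j ∈ S ∩ T, ω ∈ A j
    · obtain ⟨j, hj, hjA⟩ := h
      exact Or.inr (mem_biUnion (Finset.mem_coe.2 hj) ⟨hC, hjA⟩)
    · push Not at h
      refine Or.inl ⟨hC, mem_iInter₂.2 fun j hj => ?_⟩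
      by_cases hjT : j ∈ T
      · exact h j (Finset.mem_inter.2 ⟨hj, hjT⟩)
      · exact mem_iInter₂.1 hω j (Finset.mem_sdiff.2 ⟨hj, hjT⟩)
  have := (measureReal_mono (μ := P) h).trans ((measureReal_union_le _ _).trans
    (add_le_add_right (measureReal_biUnion_finset_le (S ∩ T) fun j => C ∩ A j) _))
  linarith

/-- A quantitative Poisson approximation for the probability that none of a finite family of
weakly dependent events occurs. -/
lemma abs_measureReal_biInter_compl_sub_exp_le {ι : Type*} [DecidableEq ι] {A A' : ι → Set Ω}
    {B : ι → Finset ι} (S : Finset ι) (hA : ∀ i ∈ S, MeasurableSet (A i))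
    (hA' : ∀ i ∈ S, MeasurableSet (A' i))
    (hind : ∀ i ∈ S, ∀ U ⊆ S, Disjoint U (B i) →
      P.real (A' i ∩ ⋂ j ∈ U, (A j)ᶜ) = P.real (A' i) * P.real (⋂ j ∈ U, (A j)ᶜ)) :
    |P.real (⋂ i ∈ S, (A i)ᶜ) - exp (-∑ i ∈ S, P.real (A i))| ≤
      ∑ i ∈ S, (P.real (A i) ^ 2 +
        ∑ j ∈ (S ∩ B i).erase i, (P.real (A i ∩ A j) + P.real (A i) * P.real (A j)) +
        2 * P.real (symmDiff (A i) (A' i))) := by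
  induction S using Finset.induction_on with
  | empty => simp
  | insert a S ha ih =>
    have ih := ih (fun i hi => hA i (Finset.mem_insert_of_mem hi))
      (fun i hi => hA' i (Finset.mem_insert_of_mem hi))
      (fun i hi U hU => hind i (Finset.mem_insert_of_mem hi) U
        (hU.trans (Finset.subset_insert _ _)))
    rw [Finset.sum_insert ha, Finset.sum_insert ha]
    have hmono : ∑ i ∈ S, (P.real (A i) ^ 2 +
        ∑ j ∈ (S ∩ B i).erase i, (P.real (A i ∩ A j) + P.real (A i) * P.real (A j)) +
        2 * P.real (symmDiff (A i) (A' i))) ≤ ∑ i ∈ S, (P.real (A i) ^ 2 +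
        ∑ j ∈ (insert a S ∩ B i).erase i, (P.real (A i ∩ A j) + P.real (A i) * P.real (A j)) +
        2 * P.real (symmDiff (A i) (A' i))) := by
      gcongr
      exact Finset.subset_insert _ _
    have hsub : S ∩ B a ⊆ (insert a S ∩ B a).erase a := fun j hj => by
      rw [Finset.mem_inter] at hj
      exact Finset.mem_erase.2 ⟨fun h => ha (h ▸ hj.1),
        Finset.mem_inter.2 ⟨Finset.mem_insert_of_mem hj.1, hj.2⟩⟩
    have hmono' : ∑ j ∈ S ∩ B a, (P.real (A a ∩ A j) + P.real (A a) * P.real (A j)) ≤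
        ∑ j ∈ (insert a S ∩ B a).erase a, (P.real (A a ∩ A j) + P.real (A a) * P.real (A j)) := by
      gcongr
    have hAa := hA a (Finset.mem_insert_self _ _)
    have hAa' := hA' a (Finset.mem_insert_self _ _)
    set p := P.real (A a) with hp
    set q := P.real (⋂ i ∈ S, (A i)ᶜ) with hq
    set U := S \ B a with hU
    set e := P.real (A a ∩ ⋂ i ∈ S, (A i)ᶜ) with he
    set D := P.real (symmDiff (A a) (A' a)) with hD
    set NU := ⋂ j ∈ U, (A j)ᶜ with hNU
    have hp0 : 0 ≤ p := measureReal_nonneg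
    have hp1 : p ≤ 1 := measureReal_le_one
    have hq0 : 0 ≤ q := measureReal_nonneg
    have hq1 : q ≤ 1 := measureReal_le_one
    have hQ : P.real (⋂ i ∈ insert a S, (A i)ᶜ) = q - e := by
      rw [Finset.set_biInter_insert, hq, he]
      have := measureReal_inter_add_sdiff (μ := P) (s := ⋂ i ∈ S, (A i)ᶜ) hAa
      rw [inter_comm (A a)ᶜ, inter_comm (A a), ← sdiff_eq]
      linarith
    have hNsub : ⋂ i ∈ S, (A i)ᶜ ⊆ NU := biInter_subset_biInter_left Finset.sdiff_subset
    have h1 := measureReal_sub_sum_le_inter_biInter_compl (P := P) A (A a) S (B a)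
    have h2 : e ≤ P.real (A a ∩ NU) := measureReal_mono (inter_subset_inter_right _ hNsub)
    have h3 : P.real NU - ∑ j ∈ S ∩ B a, P.real (A j) ≤ q := by
      have := measureReal_sub_sum_le_inter_biInter_compl (P := P) A univ S (B a)
      simp only [univ_inter] at this
      exact this
    have h4 : q ≤ P.real NU := measureReal_mono hNsub
    have h5 := hind a (Finset.mem_insert_self _ _) U
      (Finset.sdiff_subset.trans (Finset.subset_insert _ _)) Finset.sdiff_disjoint
    have hu1 : P.real NU ≤ 1 := measureReal_le_one
    have hu0 : 0 ≤ P.real NU := measureReal_nonneg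
    have key : ∀ X Y Z : Set Ω, P.real (X ∩ Z) ≤ P.real (Y ∩ Z) + P.real (symmDiff X Y) :=
      fun X Y Z => by
        refine (measureReal_mono ?_).trans (measureReal_union_le _ _)
        rintro ω ⟨hX, hZ⟩
        by_cases hY : ω ∈ Y
        · exact Or.inl ⟨hY, hZ⟩
        · exact Or.inr (Or.inl ⟨hX, hY⟩)
    have k1 := key (A a) (A' a) NU
    have k2 := key (A' a) (A a) NU
    have k3 := key (A a) (A' a) univ
    have k4 := key (A' a) (A a) univ
    rw [symmDiff_comm] at k2 k4
    simp only [inter_univ] at k3 k4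
    have hD0 : 0 ≤ D := measureReal_nonneg
    have hm1 := mul_le_mul_of_nonneg_right (sub_le_iff_le_add'.2 k3) hu0
    have hm2 := mul_le_mul_of_nonneg_right (sub_le_iff_le_add'.2 k4) hu0
    have hm3 : D * P.real NU ≤ D := mul_le_of_le_one_right hD0 hu1
    have hm4 := mul_le_mul_of_nonneg_left h3 hp0
    have hm5 := mul_le_mul_of_nonneg_left h4 hp0
    rw [Finset.sum_add_distrib, ← Finset.mul_sum] at hmono'
    have hs0 : 0 ≤ ∑ j ∈ S ∩ B a, P.real (A a ∩ A j) :=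
      Finset.sum_nonneg fun _ _ => measureReal_nonneg
    have hs1 : 0 ≤ p * ∑ j ∈ S ∩ B a, P.real (A j) :=
      mul_nonneg hp0 (Finset.sum_nonneg fun _ _ => measureReal_nonneg)
    have herr : |e - p * q| ≤ ∑ j ∈ S ∩ B a, P.real (A a ∩ A j) +
        p * ∑ j ∈ S ∩ B a, P.real (A j) + 2 * D := by
      rw [abs_le]
      constructor <;> nlinarith
    have hexp : |exp (-p) - 1 - (-p)| ≤ (-p) ^ 2 :=
      Real.abs_exp_sub_one_sub_id_le (by rw [abs_neg, abs_of_nonneg hp0]; exact hp1)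
    rw [hQ, neg_add, exp_add]
    set E := exp (-∑ i ∈ S, P.real (A i)) with hE
    have hid : q - e - exp (-p) * E =
        -((exp (-p) - 1 - (-p)) * q) + exp (-p) * (q - E) - (e - p * q) := by ring
    have ht1 : |(exp (-p) - 1 - (-p)) * q| ≤ p ^ 2 := by
      rw [abs_mul, abs_of_nonneg hq0]
      calc _ ≤ |exp (-p) - 1 - (-p)| := mul_le_of_le_one_right (abs_nonneg _) hq1
        _ ≤ _ := by simpa using hexp
    have ht2 : |exp (-p) * (q - E)| ≤ |q - E| := by
      rw [abs_mul, abs_of_pos (exp_pos _)]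
      exact mul_le_of_le_one_left (abs_nonneg _) (exp_le_one_iff.2 (by linarith))
    rw [hid]
    calc _ ≤ |(exp (-p) - 1 - (-p)) * q| + |exp (-p) * (q - E)| + |e - p * q| := by
          refine (abs_sub _ _).trans (add_le_add_left ((abs_add_le _ _).trans ?_) _)
          rw [abs_neg]
      _ ≤ _ := by linarith

end PoissonApproximation

section ExtremeValueAsymptotics

lemma tendsto_log_natCast : Tendsto (fun N : ℕ => log N) atTop atTop :=
  tendsto_log_atTop.comp tendsto_natCast_atTop_atTop

/-- The relative size of the second-order correction in `bN`, as a function of `x = log N`. -/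
noncomputable def relCorr (x : ℝ) : ℝ := (log x + log (4 * π)) / (4 * x)

lemma tendsto_relCorr : Tendsto relCorr atTop (nhds 0) := by
  have h1 : Tendsto (fun x : ℝ => log x / x) atTop (nhds 0) :=
    isLittleO_log_id_atTop.tendsto_div_nhds_zero
  have h2 : Tendsto (fun x : ℝ => log (4 * π) / x) atTop (nhds 0) :=
    tendsto_const_nhds.div_atTop tendsto_id
  have := (h1.add h2).const_mul (1 / 4)
  rw [add_zero, mul_zero] at this
  refine this.congr fun x => ?_
  unfold relCorr
  ring

lemma tendsto_mul_relCorr_sq : Tendsto (fun x => x * relCorr x ^ 2) atTop (nhds 0) := by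
  have h1 : Tendsto (fun x : ℝ => log x ^ 2 / x) atTop (nhds 0) :=
    isLittleO_pow_log_id_atTop.tendsto_div_nhds_zero
  have h2 : Tendsto (fun x : ℝ => log (4 * π) ^ 2 / x) atTop (nhds 0) :=
    tendsto_const_nhds.div_atTop tendsto_id
  have h3 := (h1.add h2).const_mul (1 / 8)
  rw [add_zero, mul_zero] at h3
  refine tendsto_of_tendsto_of_tendsto_of_le_of_le' tendsto_const_nhds h3 ?_ ?_
  · filter_upwards [eventually_gt_atTop 0] with x hx
    positivity
  · filter_upwards [eventually_gt_atTop 0] with x hx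
    unfold relCorr
    have : (log x + log (4 * π)) ^ 2 ≤ 2 * (log x ^ 2 + log (4 * π) ^ 2) := by
      nlinarith [sq_nonneg (log x - log (4 * π))]
    rw [div_pow, mul_div_assoc', ← add_div, mul_div_assoc', div_le_div_iff₀ (by positivity) hx]
    nlinarith [mul_le_mul_of_nonneg_left this (sq_nonneg x)]

variable {g : ℝ}

lemma bN_eq (g : ℝ) {N : ℕ} (hN : 0 < log N) :
    bN g N = √g * (√(2 * log N) * (1 - relCorr (log N))) := by
  have hs : 0 < √(2 * log N) := by positivity
  have h2 : √(2 * log N) ^ 2 = 2 * log N := Real.sq_sqrt (by positivity)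
  unfold bN relCorr
  congr 1
  rw [mul_sub, mul_one]
  congr 1
  rw [mul_div_assoc', div_eq_div_iff (by positivity) (by positivity)]
  linear_combination (-2 * (log (log N) + log (4 * π))) * h2

lemma tendsto_bN_sq_div_log (hg : 0 < g) :
    Tendsto (fun N : ℕ => bN g N ^ 2 / log N) atTop (nhds (2 * g)) := by
  have h := ((tendsto_relCorr.comp tendsto_log_natCast).const_sub 1).pow 2 |>.const_mul (2 * g)
  rw [sub_zero, one_pow, mul_one] at h
  refine h.congr' ?_
  filter_upwards [tendsto_log_natCast.eventually_gt_atTop 0] with N hN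
  rw [bN_eq g hN, mul_pow, mul_pow, Real.sq_sqrt hg.le, Real.sq_sqrt (by positivity)]
  simp only [Function.comp_apply]
  field_simp

lemma tendsto_bN (hg : 0 < g) : Tendsto (fun N : ℕ => bN g N) atTop atTop := by
  have h1 : Tendsto (fun N : ℕ => √g * √(2 * log N)) atTop atTop :=
    (tendsto_sqrt_atTop.comp (tendsto_log_natCast.const_mul_atTop two_pos)).const_mul_atTop
      (by positivity)
  have h2 := (tendsto_relCorr.comp tendsto_log_natCast).const_sub 1
  rw [sub_zero] at h2
  refine (h1.atTop_mul_pos one_pos h2).congr' ?_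
  filter_upwards [tendsto_log_natCast.eventually_gt_atTop 0] with N hN
  rw [bN_eq g hN, mul_assoc]
  rfl

lemma tendsto_aN (hg : 0 < g) : Tendsto (fun N : ℕ => aN g N) atTop (nhds 0) :=
  tendsto_const_nhds.div_atTop (tendsto_bN hg)

lemma eventually_aN_pos (hg : 0 < g) : ∀ᶠ N : ℕ in atTop, 0 < aN g N := by
  filter_upwards [(tendsto_bN hg).eventually_gt_atTop 0] with N hN
  exact div_pos hg hN

lemma tendsto_aN_sq_mul_log (hg : 0 < g) :
    Tendsto (fun N : ℕ => aN g N ^ 2 * log N) atTop (nhds (g / 2)) := by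
  have h := (tendsto_bN_sq_div_log hg).inv₀ (by positivity) |>.const_mul (g ^ 2)
  rw [show g ^ 2 * (2 * g)⁻¹ = g / 2 by field_simp] at h
  refine h.congr fun N => ?_
  rw [aN, inv_div, div_pow]
  ring

lemma tendsto_uN_sq_div_log (hg : 0 < g) (x : ℝ) :
    Tendsto (fun N : ℕ => uN g N x ^ 2 / log N) atTop (nhds (2 * g)) := by
  have h1 : Tendsto (fun N : ℕ => 1 + aN g N * x / bN g N) atTop (nhds 1) := by
    simpa using (((tendsto_aN hg).mul_const x).div_atTop (tendsto_bN hg)).const_add 1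
  have h := (h1.pow 2).mul (tendsto_bN_sq_div_log hg)
  rw [one_pow, one_mul] at h
  refine h.congr' ?_
  filter_upwards [(tendsto_bN hg).eventually_gt_atTop 0] with N hN
  rw [uN, mul_div_assoc', ← mul_pow, one_add_mul, div_mul_cancel₀ _ hN.ne', add_comm]

lemma tendsto_uN (hg : 0 < g) (x : ℝ) : Tendsto (fun N : ℕ => uN g N x) atTop atTop :=
  ((tendsto_aN hg).mul_const x).add_atTop (tendsto_bN hg)

lemma tendsto_density_prefactor (hg : 0 < g) :
    Tendsto (fun N : ℕ => N * (aN g N / √(2 * π * g)) * exp (-bN g N ^ 2 / (2 * g))) atTop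
      (nhds 1) := by
  have h1 := (tendsto_relCorr.comp tendsto_log_natCast).const_sub 1
  have h2 := (Real.continuous_exp.tendsto _).comp
    (tendsto_mul_relCorr_sq.comp tendsto_log_natCast).neg
  have h := (h1.inv₀ (by norm_num)).mul h2
  rw [sub_zero, inv_one, neg_zero, exp_zero, one_mul] at h
  refine h.congr' ?_
  filter_upwards [tendsto_log_natCast.eventually_gt_atTop 0,
    (tendsto_bN hg).eventually_gt_atTop 0, eventually_gt_atTop 0] with N hN hb hN0
  have hN0' : (0 : ℝ) < N := by exact_mod_cast hN0
  simp only [Function.comp_apply]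
  have hr : relCorr (log N) * (4 * log N) = log (log N) + log (4 * π) := by
    unfold relCorr
    field_simp
  have hsq : -bN g N ^ 2 / (2 * g) =
      -log N + (log (log N) + log (4 * π)) / 2 + -(log N * relCorr (log N) ^ 2) := by
    rw [← hr, bN_eq g hN, mul_pow, mul_pow, Real.sq_sqrt hg.le, Real.sq_sqrt (by positivity)]
    field_simp
    ring
  have hexp : exp ((log (log N) + log (4 * π)) / 2) = √(2 * log N) * √(2 * π) := by
    rw [← log_mul hN.ne' (by positivity), ← Real.log_sqrt (by positivity), exp_log (by positivity),
      ← Real.sqrt_mul (by positivity)]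
    congr 1
    ring
  have hs : √g ^ 2 = g := Real.sq_sqrt hg.le
  have hsg : 0 < √g := by positivity
  rw [hsq, exp_add, exp_add, hexp, exp_neg (log _), exp_log hN0', aN, Real.sqrt_mul (by positivity)]
  rw [bN_eq g hN] at hb ⊢
  have hc : 1 - relCorr (log N) ≠ 0 := fun h => by simp [h] at hb
  have hl : 0 < √(2 * log N) := by positivity
  have hpi : 0 < √(2 * π) := by positivity
  generalize √(2 * log N) = s at *
  generalize √(2 * π) = t at *
  generalize 1 - relCorr (log N) = c at *
  generalize √g = w at *
  subst hs
  field_simp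

lemma gaussianReal_real_rescaled (hg : 0 < g) (a b : ℝ) (ha : 0 < a) {T : Set ℝ}
    (hT : MeasurableSet T) :
    (gaussianReal 0 g.toNNReal).real {x | (x - b) / a ∈ T} =
      ∫ z in T, a / √(2 * π * g) * exp (-(a * z + b) ^ 2 / (2 * g)) := by
  have hmap : (gaussianReal 0 g.toNNReal).map (fun x => (x - b) / a) =
      gaussianReal (-b / a) (g / a ^ 2).toNNReal := by
    have h1 := gaussianReal_map_sub_const (μ := 0) (v := g.toNNReal) b
    have h2 := gaussianReal_map_div_const (μ := 0 - b) (v := g.toNNReal) a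
    rw [← h1, Measure.map_map (by fun_prop) (by fun_prop)] at h2
    rw [show (fun x => (x - b) / a) = (fun x => x / a) ∘ fun x => x - b from rfl, h2]
    congr 1
    · simp
    · ext
      rw [NNReal.coe_div, Real.coe_toNNReal _ hg.le, Real.coe_toNNReal _ (by positivity)]
      rfl
  have hv : (g / a ^ 2).toNNReal ≠ 0 := by
    rw [ne_eq, Real.toNNReal_eq_zero, not_le]
    positivity
  have : {x | (x - b) / a ∈ T} = (fun x => (x - b) / a) ⁻¹' T := rfl
  rw [this, measureReal_def, ← Measure.map_apply (by fun_prop) hT, hmap,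
    gaussianReal_apply_eq_integral _ hv, ENNReal.toReal_ofReal
      (integral_nonneg fun x => gaussianPDFReal_nonneg _ _ _)]
  congr 1
  ext z
  rw [gaussianPDFReal, Real.coe_toNNReal _ (by positivity)]
  have hs : √(2 * π * (g / a ^ 2)) = √(2 * π * g) / a := by
    rw [mul_div_assoc', Real.sqrt_div (by positivity), Real.sqrt_sq ha.le]
  rw [hs, inv_div]
  congr 2
  field_simp
  ring

lemma tendsto_mul_gaussianReal (hg : 0 < g) {T : Set ℝ} (hT : MeasurableSet T) {x₀ : ℝ}
    (hx₀ : T ⊆ Ioi x₀) :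
    Tendsto (fun N : ℕ => N * (gaussianReal 0 g.toNNReal).real {x | (x - bN g N) / aN g N ∈ T})
      atTop (nhds (∫ t in T, exp (-t))) := by
  set K : ℕ → ℝ := fun N => N * (aN g N / √(2 * π * g)) * exp (-bN g N ^ 2 / (2 * g)) with hK
  have hK1 : Tendsto K atTop (nhds 1) := tendsto_density_prefactor hg
  have h : Tendsto (fun N : ℕ => ∫ z in T, K N * (exp (-z) * exp (-(aN g N * z) ^ 2 / (2 * g))))
      atTop (nhds (∫ t in T, exp (-t))) := by
    refine tendsto_integral_filter_of_dominated_convergence (fun z => 2 * exp (-z))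
      (.of_forall fun N => ?_) ?_ ?_ (.of_forall fun z => ?_)
    · exact Continuous.aestronglyMeasurable (by fun_prop)
    · filter_upwards [hK1.eventually_le_const one_lt_two, eventually_aN_pos hg] with N hN ha
      refine .of_forall fun z => ?_
      have hK0 : 0 ≤ K N := by simp only [hK]; positivity
      rw [Real.norm_of_nonneg (by positivity)]
      refine mul_le_mul hN ?_ (by positivity) (by positivity)
      refine mul_le_of_le_one_right (exp_pos _).le (exp_le_one_iff.2 ?_)
      rw [neg_div]
      exact neg_nonpos.2 (by positivity)
    · exact ((integrableOn_exp_neg_Ioi x₀).mono_set hx₀).const_mul 2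
    · have h2 : Tendsto (fun N => -(aN g N * z) ^ 2 / (2 * g)) atTop (nhds 0) := by
        simpa using ((((tendsto_aN hg).mul_const z).pow 2).neg.div_const (2 * g))
      have h3 := hK1.mul (((Real.continuous_exp.tendsto _).comp h2).const_mul (exp (-z)))
      simpa using h3
  refine h.congr' ?_
  filter_upwards [eventually_aN_pos hg, (tendsto_bN hg).eventually_gt_atTop 0] with N ha hb
  rw [gaussianReal_real_rescaled hg _ _ ha hT, ← integral_const_mul]
  congr 1
  ext z
  have hab : aN g N * bN g N = g := div_mul_cancel₀ _ hb.ne'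
  have : -(aN g N * z + bN g N) ^ 2 / (2 * g) =
      -z + -(aN g N * z) ^ 2 / (2 * g) + -bN g N ^ 2 / (2 * g) := by
    field_simp
    linear_combination (-2 * z) * hab
  rw [this, exp_add, exp_add]
  simp only [hK]
  ring

end ExtremeValueAsymptotics

section ErrorTerms

variable {g : ℝ}

lemma tendsto_exp_log_mul {c : ℕ → ℝ} {c₀ : ℝ} (hc₀ : c₀ < 0) (hc : Tendsto c atTop (nhds c₀)) :
    Tendsto (fun N : ℕ => exp (log N * c N)) atTop (nhds 0) :=
  tendsto_exp_atBot.comp (tendsto_log_natCast.atTop_mul_neg hc₀ hc)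

lemma tendsto_rpow_mul_exp_neg_two_uN_sq (hg : 1 ≤ g) (x : ℝ) :
    Tendsto (fun N : ℕ => (N : ℝ) ^ (1 + 1 / (2 * (4 * g - 1))) *
      exp (-(2 * uN g N x) ^ 2 / (2 * (4 * g - 1)))) atTop (nhds 0) := by
  have hg' : 0 < 4 * g - 1 := by linarith
  have h1 := ((tendsto_uN_sq_div_log (by linarith : 0 < g) x).const_mul (2 / (4 * g - 1))).const_sub
    (1 + 1 / (2 * (4 * g - 1)))
  refine (tendsto_exp_log_mul ?_ h1).congr' ?_
  · rw [← sub_pos]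
    have : 0 - (1 + 1 / (2 * (4 * g - 1)) - 2 / (4 * g - 1) * (2 * g)) = 1 / (2 * (4 * g - 1)) := by
      field_simp
      ring
    rw [this]
    positivity
  · filter_upwards [tendsto_log_natCast.eventually_gt_atTop 0, eventually_gt_atTop 0] with N hN hN0
    rw [rpow_def_of_pos (by exact_mod_cast hN0), ← exp_add]
    congr 1
    field_simp
    ring

lemma tendsto_rpow_mul_sq {δ : ℝ} (hδ : δ < 1) {q : ℕ → ℝ} {c : ℝ}
    (hq : Tendsto (fun N : ℕ => N * q N) atTop (nhds c)) :
    Tendsto (fun N : ℕ => (N : ℝ) ^ (1 + δ) * q N ^ 2) atTop (nhds 0) := by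
  have h := (tendsto_exp_log_mul (sub_neg.2 hδ) tendsto_const_nhds).mul (hq.pow 2)
  rw [zero_mul] at h
  refine h.congr' ?_
  filter_upwards [eventually_gt_atTop 0] with N hN0
  have hN : (0 : ℝ) < N := by exact_mod_cast hN0
  rw [← rpow_def_of_pos hN, rpow_sub hN, rpow_add hN, rpow_one]
  field_simp

lemma tendsto_mul_exp_neg_aN_sq (hg : 0 < g) {η C s : ℝ} (hη : 0 < η) (hC : 0 < C) (hs : 0 < s) :
    Tendsto (fun N : ℕ => N * (2 * exp (-(aN g N * η) ^ 2 /
      (2 * (C * (⌈(N : ℝ) ^ s⌉₊ : ℝ) ^ (-(1 / 4) : ℝ)))))) atTop (nhds 0) := by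
  have h1 : Tendsto (fun N : ℕ => exp (s / 4 * log N) / log N ^ (2 : ℝ)) atTop atTop :=
    (tendsto_exp_mul_div_rpow_atTop 2 (s / 4) (by positivity)).comp tendsto_log_natCast
  have h2 := (h1.atTop_mul_pos (by positivity : 0 < g / 2 * (η ^ 2 / (2 * C)))
    ((tendsto_aN_sq_mul_log hg).mul_const (η ^ 2 / (2 * C))))
  have h3 := (tendsto_exp_atBot.comp (tendsto_log_natCast.atTop_mul_atBot₀
    (tendsto_atBot_add_const_left _ 1 (tendsto_neg_atTop_atBot.comp h2)))).const_mul 2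
  rw [mul_zero] at h3
  refine tendsto_of_tendsto_of_tendsto_of_le_of_le' tendsto_const_nhds h3
    (.of_forall fun N => by positivity) ?_
  filter_upwards [tendsto_log_natCast.eventually_gt_atTop 0, eventually_gt_atTop 0] with N hN hN0
  have hN0' : (0 : ℝ) < N := by exact_mod_cast hN0
  set L : ℝ := (⌈(N : ℝ) ^ s⌉₊ : ℝ) with hL
  have hNL : (N : ℝ) ^ s ≤ L := Nat.le_ceil _
  have hL0 : 0 < L := (rpow_pos_of_pos hN0' s).trans_le hNL
  have hL4 : exp (s / 4 * log N) ≤ L ^ (1 / 4 : ℝ) := by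
    calc exp (s / 4 * log N) = ((N : ℝ) ^ s) ^ (1 / 4 : ℝ) := by
          rw [← rpow_mul hN0'.le, rpow_def_of_pos hN0']
          congr 1
          ring
      _ ≤ _ := rpow_le_rpow (by positivity) hNL (by norm_num)
  have hsplit : (N : ℝ) * (2 * exp (-(aN g N * η) ^ 2 / (2 * (C * L ^ (-(1 / 4) : ℝ))))) =
      2 * exp (log N + -(aN g N * η) ^ 2 / (2 * (C * L ^ (-(1 / 4) : ℝ)))) := by
    rw [exp_add, exp_log hN0']
    ring
  rw [hsplit]
  simp only [Function.comp_apply]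
  gcongr 2 * exp ?_
  rw [mul_add, mul_one, rpow_neg hL0.le]
  gcongr log N + ?_
  have : log N * -(exp (s / 4 * log N) / log N ^ (2 : ℝ) *
      (aN g N ^ 2 * log N * (η ^ 2 / (2 * C)))) =
      -((aN g N * η) ^ 2 / (2 * C) * exp (s / 4 * log N)) := by
    rw [rpow_two]
    field_simp
  rw [this, show -(aN g N * η) ^ 2 / (2 * (C * (L ^ (1 / 4 : ℝ))⁻¹)) =
    -((aN g N * η) ^ 2 / (2 * C) * L ^ (1 / 4 : ℝ)) by field_simp]
  gcongr

lemma card_Icc_ceil_rpow_le {d : ℕ} (hd : d ≠ 0) {δ : ℝ} (hδ : 0 < δ) {N : ℕ} (hN : 0 < N)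
    (a : Zd d) :
    ((Finset.Icc (a - fun _ => (⌈(N : ℝ) ^ (δ / d)⌉₊ : ℤ))
      (a + fun _ => (⌈(N : ℝ) ^ (δ / d)⌉₊ : ℤ))).card : ℝ) ≤ 5 ^ d * (N : ℝ) ^ δ := by
  have hN' : (1 : ℝ) ≤ N := by exact_mod_cast hN
  have h1 : (1 : ℝ) ≤ (N : ℝ) ^ (δ / d) := one_le_rpow hN' (by positivity)
  set L := ⌈(N : ℝ) ^ (δ / d)⌉₊ with hL
  have hL1 : (L : ℝ) ≤ (N : ℝ) ^ (δ / d) + 1 := (Nat.ceil_lt_add_one (by positivity)).le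
  have hcard : (Finset.Icc (a - fun _ => (L : ℤ)) (a + fun _ => (L : ℤ))).card =
      (2 * L + 1) ^ d := by
    rw [Pi.card_Icc, Finset.prod_congr rfl (g := fun _ => 2 * L + 1), Finset.prod_const,
      Finset.card_univ, Fintype.card_fin]
    intro i _
    rw [Int.card_Icc, Pi.add_apply, Pi.sub_apply]
    omega
  have hpow : (N : ℝ) ^ δ = ((N : ℝ) ^ (δ / d)) ^ d := by
    rw [← rpow_mul_natCast (by positivity), div_mul_cancel₀ _ (by exact_mod_cast hd)]
  rw [hcard, hpow, ← mul_pow]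
  push_cast
  gcongr
  linarith

end ErrorTerms

namespace IsGaussianField

variable {Ω : Type*} [MeasurableSpace Ω] {P : Measure Ω} {d : ℕ} {φ : Zd d → Ω → ℝ}

lemma measureReal_rescaled_mem (hφ : IsGaussianField P d (green d) φ) (hd : 3 ≤ d) (a : Zd d)
    (α β : ℝ) {T : Set ℝ} (hT : MeasurableSet T) :
    P.real {ω | (φ a ω - β) / α ∈ T} =
      (gaussianReal 0 (green d 0 0).toNNReal).real {x | (x - β) / α ∈ T} := by
  have h := hφ.map_eq_of_mem_span (field_mem_span a)
  rw [hφ.variance_eq hd] at h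
  have hm : MeasurableSet {x : ℝ | (x - β) / α ∈ T} :=
    (by fun_prop : Measurable fun x : ℝ => (x - β) / α) hT
  rw [← h, map_measureReal_apply (hφ.1 a) hm]
  rfl

variable [IsProbabilityMeasure P]

lemma measureReal_inter_exceed_le (hφ : IsGaussianField P d (green d) φ) (hd : 3 ≤ d)
    {a b : Zd d} (hab : a ≠ b) {α β x₀ : ℝ} (hα : 0 < α) (hu : 0 ≤ α * x₀ + β) {S T : Set ℝ}
    (hS : S ⊆ Ioi x₀) (hT : T ⊆ Ioi x₀) :
    P.real ({ω | (φ a ω - β) / α ∈ S} ∩ {ω | (φ b ω - β) / α ∈ T}) ≤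
      exp (-(2 * (α * x₀ + β)) ^ 2 / (2 * (4 * green d 0 0 - 1))) := by
  refine (measureReal_mono ?_).trans (hφ.measureReal_ge_le
    (Submodule.add_mem _ (field_mem_span a) (field_mem_span b)) (hφ.variance_add_le hd hab)
    (by positivity))
  rintro ω ⟨h1, h2⟩
  have h1 : x₀ < (φ a ω - β) / α := hS h1
  have h2 : x₀ < (φ b ω - β) / α := hT h2
  rw [lt_div_iff₀ hα] at h1 h2
  simp only [mem_ofPred_eq, Pi.add_apply]
  linarith

lemma measureReal_indep_inter (hφ : IsGaussianField P d (green d) φ) (hd : 3 ≤ d) (L : ℕ)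
    (a : Zd d) (U : Finset (Zd d)) (hU : Disjoint U (Finset.Icc (a - fun _ => (L : ℤ))
      (a + fun _ => (L : ℤ)))) {S : Set ℝ} (hS : MeasurableSet S) {T : Zd d → Set ℝ}
    (hT : ∀ b, MeasurableSet (T b)) :
    P.real ({ω | (φ a - walkAverage φ L a) ω ∈ S} ∩ ⋂ j ∈ U, {ω | φ j ω ∈ T j}ᶜ) =
      P.real {ω | (φ a - walkAverage φ L a) ω ∈ S} * P.real (⋂ j ∈ U, {ω | φ j ω ∈ T j}ᶜ) := by
  have hfar : ∀ b ∈ (U : Set (Zd d)), ∃ i, (L : ℤ) ≤ |a i - b i| := by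
    intro b hb
    by_contra! h
    refine Finset.disjoint_left.1 hU hb (Finset.mem_Icc.2 ⟨fun i => ?_, fun i => ?_⟩) <;>
    · have := abs_lt.1 (h i)
      simp only [Pi.sub_apply, Pi.add_apply]
      linarith
  have hind := hφ.indepFun_sub_walkAverage hd L a U hfar
  set W : Set (↥(U : Set (Zd d)) → ℝ) := ⋂ b : ↥(U : Set (Zd d)), {f | f b ∈ T b}ᶜ with hW
  have hWm : MeasurableSet W :=
    .iInter fun b => ((measurable_pi_apply b) (hT b)).compl
  have hset : (⋂ j ∈ U, {ω | φ j ω ∈ T j}ᶜ) =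
      (fun ω (b : (U : Set (Zd d))) => φ b ω) ⁻¹' W := by
    ext ω
    simp [hW]
  rw [hset, measureReal_def, measureReal_def, measureReal_def, ← ENNReal.toReal_mul]
  exact congrArg ENNReal.toReal (hind.measure_inter_preimage_eq_mul S W hS hWm)

lemma measureReal_symmDiff_le (hφ : IsGaussianField P d (green d) φ) (hd : 3 ≤ d) {L : ℕ}
    (hL : 0 < L) (a : Zd d) {C : ℝ} (hC : greenTailConst d ≤ C) {α β η : ℝ} (hα : 0 < α)
    (hη : 0 < η) {T : Set ℝ} (F : Finset ℝ)
    (hF : ∀ z ∈ T, ∀ z' ∉ T, ∃ e ∈ F, e ∈ uIcc z z') :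
    P.real (symmDiff {ω | (φ a ω - β) / α ∈ T}
        {ω | ((φ a - walkAverage φ L a) ω - β) / α ∈ T}) ≤
      ∑ e ∈ F, (gaussianReal 0 (green d 0 0).toNNReal).real
        {x | (x - β) / α ∈ Icc (e - η) (e + η)} +
      2 * exp (-(α * η) ^ 2 / (2 * (C * (L : ℝ) ^ (-(1 / 4) : ℝ)))) := by
  have hsub : symmDiff {ω | (φ a ω - β) / α ∈ T}
      {ω | ((φ a - walkAverage φ L a) ω - β) / α ∈ T} ⊆
      (⋃ e ∈ F, {ω | (φ a ω - β) / α ∈ Icc (e - η) (e + η)}) ∪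
        {ω | α * η ≤ |walkAverage φ L a ω|} := by
    intro ω hω
    by_cases hh : α * η ≤ |walkAverage φ L a ω|
    · exact Or.inr hh
    refine Or.inl ?_
    rw [not_le] at hh
    have hdist : |(φ a ω - β) / α - ((φ a - walkAverage φ L a) ω - β) / α| < η := by
      rw [← sub_div, Pi.sub_apply, abs_div, abs_of_pos hα, div_lt_iff₀ hα, mul_comm η]
      rwa [show φ a ω - β - (φ a ω - walkAverage φ L a ω - β) = walkAverage φ L a ω by ring]
    obtain ⟨e, he, heI⟩ : ∃ e ∈ F, e ∈ uIcc ((φ a ω - β) / α)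
        (((φ a - walkAverage φ L a) ω - β) / α) := by
      rcases hω with ⟨h1, h2⟩ | ⟨h1, h2⟩
      · exact hF _ h1 _ h2
      · rw [uIcc_comm]
        exact hF _ h1 _ h2
    have h1 := abs_sub_left_of_mem_uIcc heI
    rw [abs_sub_comm] at hdist
    refine mem_biUnion (Finset.mem_coe.2 he) ?_
    have h2 := abs_le.1 (h1.trans hdist.le)
    simp only [mem_ofPred_eq, mem_Icc]
    constructor <;> linarith
  refine (measureReal_mono hsub).trans ((measureReal_union_le _ _).trans (add_le_add ?_ ?_))
  · refine (measureReal_biUnion_finset_le _ _).trans (Finset.sum_le_sum fun e _ => ?_)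
    rw [hφ.measureReal_rescaled_mem hd a α β measurableSet_Icc]
  · exact hφ.measureReal_abs_ge_le (walkAverage_mem_span L a)
      ((hφ.variance_walkAverage_le hd hL a).trans (by gcongr)) (by positivity)

/-- Poisson approximation of the avoidance probability of the rescaled field, with explicit
error terms. -/
lemma abs_measureReal_avoid_sub_exp_le (hφ : IsGaussianField P d (green d) φ) (hd : 3 ≤ d)
    (V : Finset (Zd d)) {T : Zd d → Set ℝ} (hT : ∀ a, MeasurableSet (T a)) {x₀ : ℝ}
    (hx₀ : ∀ a, T a ⊆ Ioi x₀) (F : Finset ℝ)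
    (hF : ∀ a, ∀ z ∈ T a, ∀ z' ∉ T a, ∃ e ∈ F, e ∈ uIcc z z') {α β η : ℝ} (hα : 0 < α)
    (hη : 0 < η) (hu : 0 ≤ α * x₀ + β) {L : ℕ} (hL : 0 < L) {C : ℝ}
    (hC : greenTailConst d ≤ C) {M : ℝ} (hM : ∀ a : Zd d, ((Finset.Icc (a - fun _ => (L : ℤ))
      (a + fun _ => (L : ℤ))).card : ℝ) ≤ M) {q : ℝ}
    (hq : q = (gaussianReal 0 (green d 0 0).toNNReal).real {x | (x - β) / α ∈ Ioi x₀}) :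
    |P.real (⋂ a ∈ V, {ω | (φ a ω - β) / α ∈ T a}ᶜ) - exp (-∑ a ∈ V,
        (gaussianReal 0 (green d 0 0).toNNReal).real {x | (x - β) / α ∈ T a})| ≤
      V.card * (q ^ 2 +
        M * (exp (-(2 * (α * x₀ + β)) ^ 2 / (2 * (4 * green d 0 0 - 1))) + q ^ 2) +
        2 * (∑ e ∈ F, (gaussianReal 0 (green d 0 0).toNNReal).real
            {x | (x - β) / α ∈ Icc (e - η) (e + η)} +
          2 * exp (-(α * η) ^ 2 / (2 * (C * (L : ℝ) ^ (-(1 / 4) : ℝ)))))) := by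
  have hp : ∀ a, (gaussianReal 0 (green d 0 0).toNNReal).real {x | (x - β) / α ∈ T a} ≤ q :=
      fun a => by
    rw [hq]
    exact measureReal_mono fun x hx => hx₀ a hx
  have hq0 : 0 ≤ q := measureReal_nonneg.trans (hp 0)
  have hmeas : ∀ a, MeasurableSet {x : ℝ | (x - β) / α ∈ T a} := fun a =>
    (by fun_prop : Measurable fun x : ℝ => (x - β) / α) (hT a)
  set A : Zd d → Set Ω := fun a => {ω | (φ a ω - β) / α ∈ T a} with hA
  set A' : Zd d → Set Ω := fun a => {ω | ((φ a - walkAverage φ L a) ω - β) / α ∈ T a} with hA'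
  set B : Zd d → Finset (Zd d) :=
    fun a => Finset.Icc (a - fun _ => (L : ℤ)) (a + fun _ => (L : ℤ)) with hB
  have hAm : ∀ a ∈ V, MeasurableSet (A a) := fun a _ => hφ.1 a (hmeas a)
  have hAm' : ∀ a ∈ V, MeasurableSet (A' a) := fun a _ => hφ.measurable_of_mem_span
      (Submodule.sub_mem _ (field_mem_span a) (walkAverage_mem_span L a)) (hmeas a)
  have hind : ∀ a ∈ V, ∀ U ⊆ V, Disjoint U (B a) →
      P.real (A' a ∩ ⋂ j ∈ U, (A j)ᶜ) = P.real (A' a) * P.real (⋂ j ∈ U, (A j)ᶜ) :=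
    fun a _ U _ hU => hφ.measureReal_indep_inter hd L a U hU (hmeas a)
      (T := fun b => {x : ℝ | (x - β) / α ∈ T b}) hmeas
  have key := abs_measureReal_biInter_compl_sub_exp_le (P := P) V hAm hAm' hind
  have hpA : ∀ a, P.real (A a) =
      (gaussianReal 0 (green d 0 0).toNNReal).real {x | (x - β) / α ∈ T a} :=
    fun a => hφ.measureReal_rescaled_mem hd a α β (hT a)
  simp_rw [hpA] at key
  refine key.trans ?_
  rw [← nsmul_eq_mul]
  refine Finset.sum_le_card_nsmul _ _ _ fun a _ => ?_
  refine add_le_add (add_le_add ?_ ?_) ?_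
  · have := hp a
    gcongr
  · refine (Finset.sum_le_card_nsmul _ _ (exp (-(2 * (α * x₀ + β)) ^ 2 /
      (2 * (4 * green d 0 0 - 1))) + q ^ 2) fun b hb => ?_).trans ?_
    · refine add_le_add (hφ.measureReal_inter_exceed_le hd (Finset.ne_of_mem_erase hb).symm hα hu
        (hx₀ a) (hx₀ b)) ?_
      rw [sq]
      exact mul_le_mul (hp a) (hp b) measureReal_nonneg hq0
    · rw [nsmul_eq_mul]
      refine mul_le_mul_of_nonneg_right (le_trans ?_ (hM a)) (by positivity)
      exact_mod_cast Finset.card_le_card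
        ((Finset.erase_subset _ _).trans Finset.inter_subset_right)
  · exact mul_le_mul_of_nonneg_left
      (hφ.measureReal_symmDiff_le hd hL a hC hα hη F (hF a)) two_pos.le

end IsGaussianField

section Limit

lemma card_VN (d n : ℕ) : (VN d n).card = n ^ d := by
  rw [VN, Fintype.card_piFinset_const, Int.card_Icc]
  simp

lemma integral_exp_neg_Icc_le (e : ℝ) {η : ℝ} (hη : 0 ≤ η) (hη1 : η ≤ 1) :
    ∫ t in Icc (e - η) (e + η), exp (-t) ≤ 2 * η * exp (1 - e) := by
  have h := norm_setIntegral_le_of_norm_le_const (μ := volume) (s := Icc (e - η) (e + η))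
    (f := fun t => exp (-t)) (C := exp (1 - e)) (by simp) fun t ht => by
      rw [Real.norm_of_nonneg (exp_pos _).le]
      exact exp_le_exp.2 (by linarith [ht.1])
  rw [Real.volume_real_Icc_of_le (by linarith)] at h
  refine (le_abs_self _).trans (h.trans_eq ?_)
  ring

variable {Ω : Type*} [MeasurableSpace Ω] {P : Measure Ω} [IsProbabilityMeasure P] {d : ℕ}
  {φ : Zd d → Ω → ℝ}

lemma IsGaussianField.tendsto_measureReal_avoid_sub_exp (hφ : IsGaussianField P d (green d) φ)
    (hd : 3 ≤ d) {T : ℕ → Zd d → Set ℝ} (hT : ∀ n a, MeasurableSet (T n a)) {x₀ : ℝ}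
    (hx₀ : ∀ n a, T n a ⊆ Ioi x₀) (F : Finset ℝ)
    (hF : ∀ n a, ∀ z ∈ T n a, ∀ z' ∉ T n a, ∃ e ∈ F, e ∈ uIcc z z') :
    Tendsto (fun n : ℕ =>
      P.real (⋂ a ∈ VN d n,
        {ω | (φ a ω - bN (green d 0 0) (n ^ d)) / aN (green d 0 0) (n ^ d) ∈ T n a}ᶜ) -
      exp (-∑ a ∈ VN d n, (gaussianReal 0 (green d 0 0).toNNReal).real
        {x | (x - bN (green d 0 0) (n ^ d)) / aN (green d 0 0) (n ^ d) ∈ T n a}))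
      atTop (nhds 0) := by
  have hg1 := one_le_green hd
  set g := green d 0 0 with hgdef
  have hg : 0 < g := by linarith
  set ν := gaussianReal 0 g.toNNReal with hν
  set δ : ℝ := 1 / (2 * (4 * g - 1)) with hδ
  have hδ0 : 0 < δ := one_div_pos.2 (by linarith)
  have hδ1 : δ < 1 := by
    rw [hδ, div_lt_one (by linarith)]
    linarith
  set C := max (greenTailConst d) 1 with hC
  have hC0 : 0 < C := lt_max_of_lt_right one_pos
  have hd0 : d ≠ 0 := by omega
  have hs : 0 < δ / d := by positivity
  set q : ℕ → ℝ := fun N => ν.real {x | (x - bN g N) / aN g N ∈ Ioi x₀} with hq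
  have hq1 := tendsto_mul_gaussianReal hg measurableSet_Ioi (subset_refl (Ioi x₀))
  have hpow : Tendsto (fun n : ℕ => n ^ d) atTop atTop := tendsto_pow_atTop hd0
  rw [Metric.tendsto_atTop']
  intro ε hε
  set S := ∑ e ∈ F, exp (1 - e) with hS
  have hS0 : 0 ≤ S := Finset.sum_nonneg fun _ _ => (exp_pos _).le
  set η := min 1 (ε / (8 * (S + 1))) with hηdef
  have hη : 0 < η := lt_min one_pos (by positivity)
  have hsmall : 2 * ∑ e ∈ F, ∫ t in Icc (e - η) (e + η), exp (-t) < ε := by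
    have h1 : ∑ e ∈ F, ∫ t in Icc (e - η) (e + η), exp (-t) ≤ 2 * η * S := by
      rw [hS, Finset.mul_sum]
      exact Finset.sum_le_sum fun e _ => integral_exp_neg_Icc_le e hη.le (min_le_left _ _)
    have h2 : η * (8 * (S + 1)) ≤ ε := by
      rw [← le_div_iff₀ (by positivity)]
      exact min_le_right _ _
    nlinarith
  have herr : Tendsto (fun N : ℕ => (N : ℝ) * (q N ^ 2 +
      5 ^ d * (N : ℝ) ^ δ * (exp (-(2 * uN g N x₀) ^ 2 / (2 * (4 * g - 1))) + q N ^ 2) +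
      2 * (∑ e ∈ F, ν.real {x | (x - bN g N) / aN g N ∈ Icc (e - η) (e + η)} +
        2 * exp (-(aN g N * η) ^ 2 / (2 * (C * (⌈(N : ℝ) ^ (δ / d)⌉₊ : ℝ) ^ (-(1 / 4) : ℝ)))))))
      atTop (nhds (2 * ∑ e ∈ F, ∫ t in Icc (e - η) (e + η), exp (-t))) := by
    have t1 := tendsto_rpow_mul_sq (δ := 0) one_pos hq1
    have t2 := (tendsto_rpow_mul_exp_neg_two_uN_sq hg1 x₀).const_mul (5 ^ d)
    have t3 := (tendsto_rpow_mul_sq hδ1 hq1).const_mul (5 ^ d)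
    have t4 := (tendsto_finsetSum F fun e _ => tendsto_mul_gaussianReal hg
      (measurableSet_Icc (a := e - η) (b := e + η)) (x₀ := e - η - 1)
      fun x hx => mem_Ioi.2 (by linarith [hx.1])).const_mul 2
    have t5 := (tendsto_mul_exp_neg_aN_sq hg hη hC0 hs).const_mul 2
    have t := (((t1.add t2).add t3).add t4).add t5
    simp only [mul_zero, zero_add, add_zero] at t
    refine t.congr' ?_
    filter_upwards [eventually_gt_atTop 0] with N hN
    have hN' : (0 : ℝ) < N := by exact_mod_cast hN
    rw [rpow_add hN', rpow_one, ← Finset.mul_sum]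
    ring
  have hbound : ∀ᶠ N : ℕ in atTop, 0 < N ∧ 0 < aN g N ∧ 0 ≤ uN g N x₀ :=
    (eventually_gt_atTop 0).and ((eventually_aN_pos hg).and
      ((tendsto_uN hg x₀).eventually_ge_atTop 0))
  have hev := hpow.eventually (hbound.and (herr.eventually_lt_const hsmall))
  obtain ⟨n₀, hn₀⟩ := eventually_atTop.1 hev
  refine ⟨n₀, fun n hn => ?_⟩
  obtain ⟨⟨hN, ha, hu⟩, hlt⟩ := hn₀ n hn.le
  rw [Real.dist_eq, sub_zero]
  refine lt_of_le_of_lt ?_ hlt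
  have hL : 0 < ⌈((n ^ d : ℕ) : ℝ) ^ (δ / d)⌉₊ :=
    Nat.ceil_pos.2 (rpow_pos_of_pos (by exact_mod_cast hN) _)
  have h := hφ.abs_measureReal_avoid_sub_exp_le hd (VN d n) (hT n) (hx₀ n) F (hF n) ha hη hu hL
    (le_max_left _ 1) (card_Icc_ceil_rpow_le hd0 hδ0 hN) (q := q (n ^ d)) rfl
  rw [card_VN] at h
  exact h

end Limit

section Counting

lemma mem_rectIdx {d n : ℕ} {lo hi : Fin d → ℝ} {a : Zd d} :
    a ∈ rectIdx d n lo hi ↔ a ∈ VN d n ∧ (fun i => (a i : ℝ) / n) ∈ rect d lo hi := by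
  classical
  exact Finset.mem_filter

lemma rectIdx_subset_VN (d n : ℕ) (lo hi : Fin d → ℝ) : rectIdx d n lo hi ⊆ VN d n :=
  fun _ h => (mem_rectIdx.1 h).1

lemma volume_rect_eq (d : ℕ) (lo hi : Fin d → ℝ) :
    volume (rect d lo hi) = volume (univ.pi fun i => Ico (0 : ℝ) 1 ∩ Ioc (lo i) (hi i)) := by
  have : rect d lo hi = univ.pi fun i => Icc (0 : ℝ) 1 ∩ Ioc (lo i) (hi i) := by
    ext t
    simp [rect]
  rw [this, volume_pi_pi, volume_pi_pi]
  exact Finset.prod_congr rfl fun i _ => measure_congr (Ico_ae_eq_Icc.symm.inter (ae_eq_refl _))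

open scoped Pointwise in
lemma tendsto_card_rectIdx_div (d : ℕ) (lo hi : Fin d → ℝ) :
    Tendsto (fun n : ℕ => ((rectIdx d n lo hi).card : ℝ) / (n : ℝ) ^ d) atTop
      (nhds (volume (rect d lo hi)).toReal) := by
  set s : Set (Fin d → ℝ) := univ.pi fun i => Ico (0 : ℝ) 1 ∩ Ioc (lo i) (hi i) with hs
  have hconv : Convex ℝ s :=
    convex_pi fun i _ => (convex_Ico 0 1).inter (convex_Ioc (lo i) (hi i))
  have hbdd : Bornology.IsBounded s :=
    Bornology.IsBounded.pi fun i => (Metric.isBounded_Ico 0 1).subset inter_subset_left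
  have hmeas : MeasurableSet s :=
    .univ_pi fun i => measurableSet_Ico.inter measurableSet_Ioc
  have h := tendsto_card_div_pow_atTop_volume s hbdd hmeas (hconv.addHaar_frontier volume)
  rw [volume_rect_eq]
  refine h.congr' ?_
  filter_upwards [eventually_gt_atTop 0] with n hn
  have hn' : (0 : ℝ) < n := by exact_mod_cast hn
  rw [Fintype.card_fin]
  congr 2
  have himg : s ∩ (n : ℝ)⁻¹ • (Submodule.span ℤ (range (Pi.basisFun ℝ (Fin d))) : Set (Fin d → ℝ)) =
      (fun (a : Zd d) i => (a i : ℝ) / n) '' (rectIdx d n lo hi : Set (Zd d)) := by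
    ext t
    simp only [mem_inter_iff, mem_image, mem_smul_set, SetLike.mem_coe,
      Module.Basis.mem_span_iff_repr_mem, Pi.basisFun_repr, hs, mem_univ_pi, rectIdx,
      Finset.mem_filter, VN, Fintype.mem_piFinset, Finset.mem_Icc, rect, mem_ofPred_eq]
    constructor
    · rintro ⟨ht, y, hy, rfl⟩
      choose a ha using hy
      have hty : (fun i => (a i : ℝ) / n) = (n : ℝ)⁻¹ • y := by
        ext i
        rw [Pi.smul_apply, ← ha i, smul_eq_mul, div_eq_inv_mul]
        rfl
      refine ⟨a, ⟨fun i => ?_, fun i => ?_⟩, hty⟩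
      · have h1 := (ht i).1
        rw [← hty] at h1
        have h2 : (0 : ℝ) ≤ a i := (le_div_iff₀ hn').1 h1.1 |>.trans' (by simp)
        have h3 : (a i : ℝ) < n := (div_lt_one hn').1 h1.2
        have h2' : 0 ≤ a i := by exact_mod_cast h2
        have h3' : a i < n := by exact_mod_cast h3
        omega
      · rw [congrFun hty i]
        exact ⟨Ico_subset_Icc_self (ht i).1, (ht i).2⟩
    · rintro ⟨a, ⟨ha, har⟩, rfl⟩
      refine ⟨fun i => ⟨⟨(har i).1.1, ?_⟩, (har i).2⟩, fun i => a i, fun i => ⟨a i, rfl⟩, ?_⟩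
      · rw [div_lt_one hn']
        have : a i < n := by have := (ha i).2; omega
        exact_mod_cast this
      · ext i
        simp [div_eq_inv_mul]
  have hinj : Function.Injective fun (a : Zd d) i => (a i : ℝ) / n := fun a b hab => by
    ext i
    have := congrFun hab i
    simpa [div_left_inj' hn'.ne'] using this
  rw [himg, Nat.card_image_of_injective hinj]
  simp

end Counting

section FiniteUnions

lemma IsFiniteUnionIoc.exists_preimage_props {R : Set EReal} (hR : IsFiniteUnionIoc R) :
    MeasurableSet {t : ℝ | (t : EReal) ∈ R} ∧ (∃ x₀ : ℝ, {t : ℝ | (t : EReal) ∈ R} ⊆ Ioi x₀) ∧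
      ∃ F : Finset ℝ, ∀ z : ℝ, (z : EReal) ∈ R → ∀ z' : ℝ, (z' : EReal) ∉ R →
        ∃ e ∈ F, e ∈ uIcc z z' := by
  classical
  obtain ⟨m, w, r, hwr, -, rfl⟩ := hR
  refine ⟨?_, ?_, Finset.univ.image w ∪ Finset.univ.image fun l => (r l).toReal, ?_⟩
  · exact measurable_coe_real_ereal (MeasurableSet.iUnion fun l => measurableSet_Ioc)
  · obtain ⟨x, hx⟩ := (finite_range w).bddBelow
    refine ⟨x, fun t ht => ?_⟩
    obtain ⟨l, hl⟩ := mem_iUnion.1 ht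
    exact (hx ⟨l, rfl⟩).trans_lt (EReal.coe_lt_coe_iff.1 hl.1)
  · intro z hz z' hz'
    obtain ⟨l, hl⟩ := mem_iUnion.1 hz
    have hl' : (z' : EReal) ∉ Ioc (w l : EReal) (r l) := fun h => hz' (mem_iUnion.2 ⟨l, h⟩)
    have hwz : w l < z := EReal.coe_lt_coe_iff.1 hl.1
    by_cases h : (w l : EReal) < z'
    · have hr : r l < z' := not_le.1 fun hle => hl' ⟨h, hle⟩
      have hrr : ((r l).toReal : EReal) = r l := EReal.coe_toReal hr.ne_top (hwr l).ne_bot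
      have h1 := hl.2
      rw [← hrr] at hr h1
      refine ⟨(r l).toReal, by simp, Icc_subset_uIcc ⟨EReal.coe_le_coe_iff.1 h1,
        (EReal.coe_lt_coe_iff.1 hr).le⟩⟩
    · exact ⟨w l, by simp, Icc_subset_uIcc' ⟨EReal.coe_le_coe_iff.1 (not_lt.1 h), hwz.le⟩⟩

end FiniteUnions

/-- Avoidance probabilities of the extremal process of the infinite-volume DGFF
converge to those of a Poisson point process with intensity `dt ⊗ e^{-z}dz`. -/
theorem extremal_process_infinite_volume
    (d : ℕ) (hd : 3 ≤ d)
    {Ω : Type*} [MeasurableSpace Ω] (P : Measure Ω) [IsProbabilityMeasure P]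
    (φ : Zd d → Ω → ℝ) (hφ : IsGaussianField P d (green d) φ)
    (k : ℕ) (hk : 1 ≤ k)
    (lo hi : Fin k → Fin d → ℝ) (hlohi : ∀ j i, lo j i < hi j i)
    (hdisj : Pairwise fun j j' => Disjoint (rect d (lo j) (hi j)) (rect d (lo j') (hi j')))
    (R : Fin k → Set EReal) (hR : ∀ j, IsFiniteUnionIoc (R j)) :
    Tendsto
      (fun n : ℕ =>
        (P {ω | ∀ j : Fin k, ∀ a ∈ rectIdx d n (lo j) (hi j),
            (((φ a ω - bN (green d 0 0) (n ^ d)) / aN (green d 0 0) (n ^ d) : ℝ) : EReal)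
              ∉ R j}).toReal)
      atTop
      (nhds (Real.exp (-∑ j : Fin k, (volume (rect d (lo j) (hi j))).toReal * omegaMeas (R j)))) := by
  have hg : 0 < green d 0 0 := one_pos.trans_le (one_le_green hd)
  have hmeas := fun j => (hR j).exists_preimage_props.1
  choose x hx using fun j => (hR j).exists_preimage_props.2.1
  choose F hF using fun j => (hR j).exists_preimage_props.2.2
  set T : Fin k → Set ℝ := fun j => {t : ℝ | (t : EReal) ∈ R j} with hTdef
  set U : ℕ → Zd d → Set ℝ := fun n a => ⋃ j, ⋃ _ : a ∈ rectIdx d n (lo j) (hi j), T j with hU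
  obtain ⟨x₀, hx₀⟩ := (finite_range x).bddBelow
  have hUmeas : ∀ n a, MeasurableSet (U n a) := fun n a =>
    .iUnion fun j => .iUnion fun _ => hmeas j
  have hUx₀ : ∀ n a, U n a ⊆ Ioi x₀ := fun n a => iUnion_subset fun j => iUnion_subset fun _ =>
    (hx j).trans (Ioi_subset_Ioi (hx₀ ⟨j, rfl⟩))
  have hUF : ∀ n a, ∀ z ∈ U n a, ∀ z' ∉ U n a,
      ∃ e ∈ Finset.univ.biUnion F, e ∈ uIcc z z' := by
    intro n a z hz z' hz'
    simp only [hU, mem_iUnion, exists_prop, not_exists, not_and] at hz hz'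
    obtain ⟨j, haj, hzj⟩ := hz
    obtain ⟨e, he, hez⟩ := hF j z hzj z' (hz' j haj)
    exact ⟨e, Finset.mem_biUnion.2 ⟨j, Finset.mem_univ j, he⟩, hez⟩
  have hlim := hφ.tendsto_measureReal_avoid_sub_exp hd hUmeas hUx₀ _ hUF
  have hsum : ∀ n : ℕ, ∑ a ∈ VN d n, (gaussianReal 0 (green d 0 0).toNNReal).real
      {y | (y - bN (green d 0 0) (n ^ d)) / aN (green d 0 0) (n ^ d) ∈ U n a} =
      ∑ j, (rectIdx d n (lo j) (hi j)).card * (gaussianReal 0 (green d 0 0).toNNReal).real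
        {y | (y - bN (green d 0 0) (n ^ d)) / aN (green d 0 0) (n ^ d) ∈ T j} := by
    intro n
    have hunique : ∀ a j j', a ∈ rectIdx d n (lo j) (hi j) → a ∈ rectIdx d n (lo j') (hi j') →
        j = j' := fun a j j' h h' => by
      by_contra hne
      exact Set.disjoint_left.1 (hdisj hne) (mem_rectIdx.1 h).2 (mem_rectIdx.1 h').2
    have hpoint : ∀ a, (gaussianReal 0 (green d 0 0).toNNReal).real
        {y | (y - bN (green d 0 0) (n ^ d)) / aN (green d 0 0) (n ^ d) ∈ U n a} =
        ∑ j, if a ∈ rectIdx d n (lo j) (hi j) then (gaussianReal 0 (green d 0 0).toNNReal).real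
          {y | (y - bN (green d 0 0) (n ^ d)) / aN (green d 0 0) (n ^ d) ∈ T j} else 0 := by
      intro a
      by_cases h : ∃ j, a ∈ rectIdx d n (lo j) (hi j)
      · obtain ⟨j, hj⟩ := h
        have hUT : U n a = T j := by
          ext t
          simp only [hU, mem_iUnion, exists_prop]
          exact ⟨fun ⟨j', h', ht⟩ => hunique a j' j h' hj ▸ ht, fun ht => ⟨j, hj, ht⟩⟩
        rw [hUT, Finset.sum_eq_single j (fun j' _ hne => if_neg fun h' => hne (hunique a j' j h' hj))
          (fun h => absurd (Finset.mem_univ j) h), if_pos hj]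
      · push Not at h
        have hU0 : U n a = ∅ := by simp [hU, h]
        simp [hU0, h]
    simp_rw [hpoint]
    rw [Finset.sum_comm]
    refine Finset.sum_congr rfl fun j _ => ?_
    rw [← Finset.sum_filter, Finset.filter_mem_eq_inter,
      Finset.inter_eq_right.2 (rectIdx_subset_VN _ _ _ _), Finset.sum_const, nsmul_eq_mul]
  have hsumlim : Tendsto (fun n : ℕ => ∑ j, ((rectIdx d n (lo j) (hi j)).card : ℝ) *
      (gaussianReal 0 (green d 0 0).toNNReal).real
        {y | (y - bN (green d 0 0) (n ^ d)) / aN (green d 0 0) (n ^ d) ∈ T j}) atTop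
      (nhds (∑ j, (volume (rect d (lo j) (hi j))).toReal * omegaMeas (R j))) := by
    refine tendsto_finsetSum _ fun j _ => ?_
    have h := (tendsto_card_rectIdx_div d (lo j) (hi j)).mul
      ((tendsto_mul_gaussianReal hg (hmeas j) (hx j)).comp (tendsto_pow_atTop (by omega : d ≠ 0)))
    refine h.congr' ?_
    filter_upwards [eventually_gt_atTop 0] with n hn
    have hn' : (0 : ℝ) < n := by exact_mod_cast hn
    simp only [Function.comp_apply, Nat.cast_pow]
    field_simp
    rfl
  simp_rw [hsum] at hlim
  have h := hlim.add ((Real.continuous_exp.tendsto _).comp hsumlim.neg)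
  simp only [Function.comp_apply, sub_add_cancel, zero_add] at h
  refine h.congr fun n => ?_
  rw [measureReal_def]
  congr 2
  ext ω
  simp only [hU, hTdef, mem_iInter, mem_compl_iff, mem_iUnion, exists_prop, not_exists, not_and,
    mem_ofPred_eq]
  exact ⟨fun h j a ha => h a (rectIdx_subset_VN _ _ _ _ ha) j ha, fun h a _ j ha => h j a ha⟩
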